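/- arXiv:2305.14170 — 3 statements merged into one kernel-verified Lean document; each statement's English description precedes it below -/
import Mathlib

section
/- For all integers m ≥ 1, d ≥ 2, every 2 ≤ t ≤ s ≤ d, and all n ≥ 0: a^{⟨s,t⟩}_{m,d}(dn) + a^{⟨s−1,t−1⟩}_{m,d}(dn) = g^{⟨s−1,t−1⟩}_{m,d}(dn). Equivalently, as formal power series, A^{⟨s,t⟩}_{m,d}(x) = G^{⟨s−1,t−1⟩}_{m,d}(x) − A^{⟨s−1,t−1⟩}_{m,d}(x). -/
/-- A step of a lattice path: up `(1,1)`, down `(1,-1)`, or horizontal `(1,0)`. -/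
inductive DStep : Type
  | U : DStep
  | D : DStep
  | L : DStep
  deriving DecidableEq

/-- The vertical displacement of a step. -/
def DStep.val : DStep → ℤ
  | .U => 1
  | .D => -1
  | .L => 0

/-- Total vertical displacement of a word of steps. -/
def stepSum (w : List DStep) : ℤ := (w.map DStep.val).sum

/-- A word of the form `D^a L^b U^c` with `a + b + c = d`. -/
def IsPieceWord (d : ℕ) (p : List DStep) : Prop :=
  ∃ a b c : ℕ, a + b + c = d ∧
    p = List.replicate a DStep.D ++ List.replicate b DStep.L ++ List.replicate c DStep.U

/-- `M` is a DLU path of length `d*n` from `(0,s)` to `(d*n,t)`: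
each consecutive block (piece) of `d` steps has the form `D^a L^b U^c`,
the path starts at height `s`, ends at height `t`, and never passes below the x-axis. -/
def IsDLUPath (d n s t : ℕ) (M : List DStep) : Prop :=
  M.length = d * n ∧
  (∀ i < n, IsPieceWord d ((M.drop (d * i)).take d)) ∧
  (s : ℤ) + stepSum M = (t : ℤ) ∧
  ∀ k ≤ M.length, 0 ≤ (s : ℤ) + stepSum (M.take k)

/-- The completed path `M̂ = L^{d-s} U^s M D^t L^{d-t}`. -/
def hatPath (d s t : ℕ) (M : List DStep) : List DStep :=
  List.replicate (d - s) DStep.L ++ List.replicate s DStep.U ++ M ++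
    List.replicate t DStep.D ++ List.replicate (d - t) DStep.L

/-- `w` contains a contiguous subpath `U P D` with `P ∈ {∅, L^d, L^{2d}, …, L^{(m-2)d}}`. -/
def HasShortUD (m d : ℕ) (w : List DStep) : Prop :=
  ∃ k : ℕ, k + 2 ≤ m ∧
    ([DStep.U] ++ List.replicate (k * d) DStep.L ++ [DStep.D]) <:+: w

/-- `w` is `m`-regular: it contains no subpath `U P D` with
`P ∈ {∅, L^d, L^{2d}, …, L^{(m-2)d}}`. -/
def RegularWord (m d : ℕ) (w : List DStep) : Prop := ¬ HasShortUD m d w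

/-- `w` has pattern `Λ`: it contains a contiguous subpath `U U P D D` in which the two `U`'s
lie in a common piece (block of `d` steps), the two `D`'s lie in a common piece, and `P`
starts and ends at the same height `h` and never passes below height `h`. -/
def HasLambda (d : ℕ) (w : List DStep) : Prop :=
  ∃ pre P suf : List DStep,
    w = pre ++ [DStep.U, DStep.U] ++ P ++ [DStep.D, DStep.D] ++ suf ∧
    (pre.length + 1) % d ≠ 0 ∧
    (pre.length + P.length + 3) % d ≠ 0 ∧
    stepSum P = 0 ∧
    (∀ k ≤ P.length, 0 ≤ stepSum (P.take k))

/-- An `m`-regular `Λ`-avoiding DLU path of length `d*n` from `(0,s)` to `(d*n,t)`: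
the regularity and `Λ`-avoidance conditions are imposed on the completed path `M̂`. -/
def IsGoodPath (m d n s t : ℕ) (M : List DStep) : Prop :=
  IsDLUPath d n s t M ∧ RegularWord m d (hatPath d s t M) ∧ ¬ HasLambda d (hatPath d s t M)

/-- A prime path: an `m`-regular `Λ`-avoiding DLU path which never touches the x-axis. -/
def IsPrimePath (m d n s t : ℕ) (M : List DStep) : Prop :=
  IsGoodPath m d n s t M ∧ ∀ k ≤ M.length, 0 < (s : ℤ) + stepSum (M.take k)

/-- `g^{⟨s,t⟩}_{m,d}(dn)`: the number of `m`-regular `Λ`-avoiding DLU paths of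
length `d*n` from `(0,s)` to `(d*n,t)`. -/
noncomputable def gCount (m d n s t : ℕ) : ℕ := {M : List DStep | IsGoodPath m d n s t M}.ncard

/-- `a^{⟨s,t⟩}_{m,d}(dn)`: the number of prime `m`-regular `Λ`-avoiding DLU paths of
length `d*n` from `(0,s)` to `(d*n,t)`. -/
noncomputable def aCount (m d n s t : ℕ) : ℕ := {M : List DStep | IsPrimePath m d n s t M}.ncard

/-- The generating function `G^{⟨s,t⟩}_{m,d}(x) = Σ_{n≥0} g^{⟨s,t⟩}_{m,d}(dn) x^{dn}`. -/
noncomputable def Gps (m d s t : ℕ) : PowerSeries ℤ :=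
  PowerSeries.mk fun N => if d ∣ N then (gCount m d (N / d) s t : ℤ) else 0

/-- The generating function `A^{⟨s,t⟩}_{m,d}(x) = Σ_{n≥0} a^{⟨s,t⟩}_{m,d}(dn) x^{dn}`. -/
noncomputable def Aps (m d s t : ℕ) : PowerSeries ℤ :=
  PowerSeries.mk fun N => if d ∣ N then (aCount m d (N / d) s t : ℤ) else 0

/-- `C_{m,d}(x) = (x^{d(m-1)} - 1)/(x^d - 1) = Σ_{k=0}^{m-2} x^{dk}`. -/
noncomputable def Cps (m d : ℕ) : PowerSeries ℤ :=
  ∑ k ∈ Finset.range (m - 1), (PowerSeries.X : PowerSeries ℤ) ^ (d * k)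

/-- `S` is a `d`-contact stack on `[n]`: a set of arcs `(i,j)` with `1 ≤ i < j ≤ n`,
noncrossing, in which every vertex lies in at most `d` arcs. -/
def IsContactStack (d n : ℕ) (S : Finset (ℕ × ℕ)) : Prop :=
  (∀ p ∈ S, 1 ≤ p.1 ∧ p.1 < p.2 ∧ p.2 ≤ n) ∧
  (∀ p ∈ S, ∀ q ∈ S, ¬ (p.1 < q.1 ∧ q.1 < p.2 ∧ p.2 < q.2)) ∧
  (∀ v : ℕ, (S.filter fun p => p.1 = v ∨ p.2 = v).card ≤ d)

/-- Every arc of `S` has length at least `m`. -/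
def ArcsRegular (m : ℕ) (S : Finset (ℕ × ℕ)) : Prop := ∀ p ∈ S, m ≤ p.2 - p.1

/-- `S` is an `m`-regular `d`-contact stack on `[n]`. -/
def IsStack (m d n : ℕ) (S : Finset (ℕ × ℕ)) : Prop :=
  IsContactStack d n S ∧ ArcsRegular m S

/-- The left degree of vertex `v`: the number of arcs ending at `v`. -/
def ldeg (S : Finset (ℕ × ℕ)) (v : ℕ) : ℕ := (S.filter fun p => p.2 = v).card

/-- The right degree of vertex `v`: the number of arcs starting at `v`. -/
def rdeg (S : Finset (ℕ × ℕ)) (v : ℕ) : ℕ := (S.filter fun p => p.1 = v).card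

/-- The map `η`, sending a stack `S` on `[n]` to the word `P_1 P_2 ⋯ P_n` where
`P_v = D^{ldeg v} L^{d - ldeg v - rdeg v} U^{rdeg v}`. -/
def eta (d n : ℕ) (S : Finset (ℕ × ℕ)) : List DStep :=
  (List.range n).flatMap fun i =>
    List.replicate (ldeg S (i + 1)) DStep.D ++
      List.replicate (d - ldeg S (i + 1) - rdeg S (i + 1)) DStep.L ++
      List.replicate (rdeg S (i + 1)) DStep.U

/-- `s_{m,d}(n)`: the number of `m`-regular `d`-contact stacks on `[n]`. -/
noncomputable def sCount (m d n : ℕ) : ℕ := {S : Finset (ℕ × ℕ) | IsStack m d n S}.ncard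

/-- The generating function `S_{m,d}(x) = Σ_{n≥0} s_{m,d}(n) xⁿ`. -/
noncomputable def Sps (m d : ℕ) : PowerSeries ℤ := PowerSeries.mk fun n => (sCount m d n : ℤ)

theorem finite_words (N : ℕ) : {M : List DStep | M.length = N}.Finite := by
  haveI : Finite DStep := by
    refine Finite.of_surjective (fun i : Fin 3 => ![DStep.U, DStep.D, DStep.L] i) ?_
    intro x
    cases x
    · exact ⟨0, rfl⟩
    · exact ⟨1, rfl⟩
    · exact ⟨2, rfl⟩
  exact List.finite_length_eq DStep N

/-- Height after `k` steps. -/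
def hgt (w : List DStep) (k : ℕ) : ℤ := stepSum (w.take k)

theorem stepSum_append (a b : List DStep) : stepSum (a ++ b) = stepSum a + stepSum b := by
  simp [stepSum]

theorem hgt_append (a b : List DStep) (k : ℕ) :
    hgt (a ++ b) k = hgt a k + hgt b (k - a.length) := by
  simp [hgt, List.take_append, stepSum_append]

theorem hgt_replicate (n k : ℕ) (x : DStep) :
    hgt (List.replicate n x) k = (min k n : ℕ) * x.val := by
  simp [hgt, List.take_replicate, stepSum]

theorem hgt_hat (d s t k : ℕ) (M : List DStep) :
    hgt (hatPath d s t M) k = (min (k - (d - s)) s : ℕ) + hgt M (k - (d - s) - s)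
      - (min (k - (d - s) - s - M.length) t : ℕ) := by
  simp only [hatPath, hgt_append, hgt_replicate, List.length_append, List.length_replicate,
    DStep.val, Nat.sub_add_eq]
  ring

theorem get_hat (d s t i : ℕ) (M : List DStep) :
    (hatPath d s t M)[i]? =
      if i < d - s then some DStep.L else if i < d - s + s then some DStep.U
      else if i < d - s + s + M.length then M[i - (d - s + s)]?
      else if i < d - s + s + M.length + t then some DStep.D
      else if i < d - s + s + M.length + t + (d - t) then some DStep.L else none := by
  simp only [hatPath, List.getElem?_append, List.length_append, List.length_replicate,
    List.getElem?_replicate]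
  split_ifs <;> first | rfl | omega

theorem hgt_drop (w : List DStep) (i k : ℕ) : hgt (w.drop i) k = hgt w (i + k) - hgt w i := by
  have : w.take (i + k) = w.take i ++ (w.drop i).take k := List.take_add
  simp only [hgt, this, stepSum_append]
  ring

theorem decomp2 (w : List DStep) (i : ℕ) (x y : DStep) (hx : w[i]? = some x)
    (hy : w[i+1]? = some y) : w = w.take i ++ [x, y] ++ w.drop (i + 2) := by
  obtain ⟨h1, rfl⟩ := List.getElem?_eq_some_iff.1 hx
  obtain ⟨h2, rfl⟩ := List.getElem?_eq_some_iff.1 hy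
  conv_lhs => rw [← List.take_append_drop i w, List.drop_eq_getElem_cons h1,
    List.drop_eq_getElem_cons h2]
  simp

theorem hasLambda_iff (d : ℕ) (w : List DStep) : HasLambda d w ↔
    ∃ i j : ℕ, w[i]? = some DStep.U ∧ w[i+1]? = some DStep.U ∧ i + 2 ≤ j ∧
      w[j]? = some DStep.D ∧ w[j+1]? = some DStep.D ∧ (i + 1) % d ≠ 0 ∧ (j + 1) % d ≠ 0 ∧
      hgt w j = hgt w (i + 2) ∧ ∀ k, i + 2 ≤ k → k ≤ j → hgt w (i + 2) ≤ hgt w k := by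
  constructor
  · rintro ⟨pre, P, suf, rfl, h1, h2, h3, h4⟩
    have key : ∀ k ≤ P.length, hgt (pre ++ [DStep.U, DStep.U] ++ P ++ [DStep.D, DStep.D] ++ suf)
        (pre.length + 2 + k) = hgt (pre ++ [DStep.U, DStep.U]) (pre.length + 2) + hgt P k := by
      intro k hk
      have e1 : pre.length + 2 + k - (pre ++ [DStep.U, DStep.U]).length = k := by simp
      have e2 : pre.length + 2 + k - (pre ++ [DStep.U, DStep.U] ++ P).length = 0 := by
        simp; omega
      have e3 : pre.length + 2 + k -
        (pre ++ [DStep.U, DStep.U] ++ P ++ [DStep.D, DStep.D]).length = 0 := by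
        simp; omega
      rw [hgt_append, hgt_append, hgt_append (_ ++ _) P, e1, e2, e3]
      have e4 : hgt (pre ++ [DStep.U, DStep.U]) (pre.length + 2 + k)
          = hgt (pre ++ [DStep.U, DStep.U]) (pre.length + 2) := by
        unfold hgt
        rw [List.take_of_length_le (by simp), List.take_of_length_le (by simp)]
      rw [e4]
      simp [hgt, stepSum]
    refine ⟨pre.length, pre.length + 2 + P.length, ?_, ?_, by omega, ?_, ?_, h1, ?_, ?_, ?_⟩
    · simp
    · simp
    · simp [List.getElem?_append]; grind
    · simp [List.getElem?_append]; grind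
    · convert h2 using 2; omega
    · have a := key P.length le_rfl
      have b := key 0 (by omega)
      have c : hgt P P.length = 0 := by simpa [hgt] using h3
      have e : hgt P 0 = 0 := by simp [hgt, stepSum]
      rw [add_zero] at b
      rw [a, b, c, e]
    · intro k hk1 hk2
      have a := key (k - (pre.length + 2)) (by omega)
      have b := key 0 (by omega)
      have e : hgt P 0 = 0 := by simp [hgt, stepSum]
      rw [add_zero] at b
      rw [show pre.length + 2 + (k - (pre.length + 2)) = k by omega] at a
      rw [a, b, e]
      have := h4 (k - (pre.length + 2)) (by omega)
      unfold hgt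
      unfold hgt at *
      omega
  · rintro ⟨i, j, hi, hi', hij, hj, hj', m1, m2, h3, h4⟩
    have hl : j + 1 < w.length := (List.getElem?_eq_some_iff.1 hj').1
    refine ⟨w.take i, (w.drop (i + 2)).take (j - (i + 2)), w.drop (j + 2), ?_, ?_, ?_, ?_, ?_⟩
    · conv_lhs => rw [decomp2 w i _ _ hi hi']
      have := decomp2 (w.drop (i + 2)) (j - (i + 2)) DStep.D DStep.D
        (by rw [List.getElem?_drop]; convert hj using 2; omega)
        (by rw [List.getElem?_drop]; convert hj' using 2; omega)
      conv_lhs => rw [this]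
      rw [List.drop_drop, show i + 2 + (j - (i + 2) + 2) = j + 2 by omega]
      simp
    · rw [List.length_take, min_eq_left (by omega)]; exact m1
    · rw [List.length_take, List.length_take, List.length_drop, min_eq_left (by omega),
        min_eq_left (by omega)]
      convert m2 using 2; omega
    · have := hgt_drop w (i + 2) (j - (i + 2))
      rw [show i + 2 + (j - (i + 2)) = j by omega] at this
      unfold hgt at *
      omega
    · intro k hk
      rw [List.length_take] at hk
      have := hgt_drop w (i + 2) k
      have := h4 (i + 2 + k) (by omega) (by omega)
      rw [List.take_take, min_eq_left (by omega)]
      unfold hgt at *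
      omega

theorem hasShort_iff (m d : ℕ) (w : List DStep) : HasShortUD m d w ↔
    ∃ k i : ℕ, k + 2 ≤ m ∧ w[i]? = some DStep.U ∧ w[i + 1 + k * d]? = some DStep.D ∧
      ∀ j, i < j → j < i + 1 + k * d → w[j]? = some DStep.L := by
  unfold HasShortUD
  constructor
  · rintro ⟨k, hk, pre, suf, rfl⟩
    refine ⟨k, pre.length, hk, ?_, ?_, ?_⟩
    · simp
    · simp [List.getElem?_append]; grind
    · intro j h1 h2
      obtain ⟨r, rfl⟩ : ∃ r, j = pre.length + 1 + r := ⟨j - (pre.length + 1), by omega⟩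
      simp [List.getElem?_append, List.getElem?_replicate]
      grind
  · rintro ⟨k, i, hk, h1, h2, h3⟩
    refine ⟨k, hk, ?_⟩
    have hl := (List.getElem?_eq_some_iff.1 h2).1
    have : [DStep.U] ++ List.replicate (k * d) DStep.L ++ [DStep.D]
        = (w.drop i).take (k * d + 2) := by
      apply List.ext_getElem?
      intro r
      rw [List.getElem?_take, List.getElem?_drop]
      rcases Nat.eq_zero_or_pos r with rfl | hr
      · simp [h1]
      · rcases lt_trichotomy r (k * d + 1) with h | h | h
        · rw [if_pos (by omega), h3 (i + r) (by omega) (by omega)]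
          simp [List.getElem?_append, List.getElem?_replicate]
          grind
        · rw [if_pos (by omega), h, show i + (k * d + 1) = i + 1 + k * d by omega, h2]
          simp [List.getElem?_append, List.getElem?_replicate]
        · rw [if_neg (by omega)]
          simp; omega
    rw [this]
    exact (List.take_prefix _ _).isInfix.trans (List.drop_suffix _ _).isInfix

theorem short_hat (m d s t : ℕ) (hs : 1 ≤ s) (ht : 1 ≤ t) (hsd : s < d) (htd : t < d)
    (M : List DStep) :
    HasShortUD m d (hatPath d (s + 1) (t + 1) M) ↔ HasShortUD m d (hatPath d s t M) := by
  have h2 := fun i => get_hat d (s + 1) (t + 1) i M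
  have h1 := fun i => get_hat d s t i M
  rw [show d - s + s = d by omega] at h1
  rw [show d - (s + 1) + (s + 1) = d by omega] at h2
  have same : ∀ i, d - s ≤ i → i < d + M.length + t →
      (hatPath d (s + 1) (t + 1) M)[i]? = (hatPath d s t M)[i]? := by
    intro i a b
    rw [h1, h2]
    split_ifs <;> first | rfl | omega
  rw [hasShort_iff, hasShort_iff]
  constructor
  · rintro ⟨k, i, hk, a, b, c⟩
    have hi : d - s ≤ i := by
      by_contra hc
      have hi : i = d - (s + 1) := by
        by_contra hc'
        rw [h2, if_pos (by omega)] at a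
        simp at a
      have hU : (hatPath d (s + 1) (t + 1) M)[i + 1]? = some DStep.U := by
        rw [h2, if_neg (by omega), if_pos (by omega)]
      rcases Nat.eq_zero_or_pos (k * d) with h0 | h0
      · rw [h0, add_zero, hU] at b; simp at b
      · rw [c (i + 1) (by omega) (by omega)] at hU; simp at hU
    have hj : i + 1 + k * d < d + M.length + t := by
      by_contra hc
      have hi : i + 1 + k * d = d + M.length + t := by
        by_contra hc'
        rw [h2, if_neg (by omega), if_neg (by omega), if_neg (by omega), if_neg (by omega)] at b
        split_ifs at b <;> simp at b
      have hU : (hatPath d (s + 1) (t + 1) M)[i + k * d]? = some DStep.D := by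
        rw [h2, if_neg (by omega), if_neg (by omega), if_neg (by omega), if_pos (by omega)]
      rcases Nat.eq_zero_or_pos (k * d) with h0 | h0
      · rw [h0, add_zero, a] at hU; simp at hU
      · rw [c (i + k * d) (by omega) (by omega)] at hU; simp at hU
    refine ⟨k, i, hk, ?_, ?_, ?_⟩
    · rw [← same i hi (by omega), a]
    · rw [← same _ (by omega) hj, b]
    · intro j j1 j2
      rw [← same _ (by omega) (by omega), c j j1 j2]
  · rintro ⟨k, i, hk, a, b, c⟩
    have hi : d - s ≤ i := by
      by_contra hc
      rw [h1, if_pos (by omega)] at a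
      simp at a
    have hj : i + 1 + k * d < d + M.length + t := by
      by_contra hc
      rw [h1, if_neg (by omega), if_neg (by omega), if_neg (by omega), if_neg (by omega)] at b
      split_ifs at b <;> simp at b
    refine ⟨k, i, hk, ?_, ?_, ?_⟩
    · rw [same i hi (by omega), a]
    · rw [same _ (by omega) hj, b]
    · intro j j1 j2
      rw [same _ (by omega) (by omega), c j j1 j2]

theorem lambda_hat (d n s t : ℕ) (hs : 1 ≤ s) (ht : 1 ≤ t) (hsd : s < d) (htd : t < d)
    (M : List DStep) (hlen : M.length = d * n) (hsum : (s : ℤ) + stepSum M = t)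
    (hpos : ∀ k ≤ M.length, 0 ≤ (s : ℤ) + stepSum (M.take k)) :
    HasLambda d (hatPath d (s + 1) (t + 1) M) ↔ (HasLambda d (hatPath d s t M) ∨
      ∀ k ≤ M.length, 0 < (s : ℤ) + stepSum (M.take k)) := by
  have h2 := fun i => get_hat d (s + 1) (t + 1) i M
  have h1 := fun i => get_hat d s t i M
  rw [show d - s + s = d by omega] at h1
  rw [show d - (s + 1) + (s + 1) = d by omega] at h2
  have same : ∀ i, d - s ≤ i → i < d + M.length + t →
      (hatPath d (s + 1) (t + 1) M)[i]? = (hatPath d s t M)[i]? := by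
    intro i a b
    rw [h1, h2]
    split_ifs <;> first | rfl | omega
  have g2 := fun k => hgt_hat d (s + 1) (t + 1) k M
  have g1 := fun k => hgt_hat d s t k M
  have z0 : hgt M 0 = 0 := by simp [hgt, stepSum]
  have zpos : ∀ k, 0 ≤ (s : ℤ) + hgt M k := by
    intro k
    rcases le_total k M.length with h | h
    · exact hpos k h
    · unfold hgt
      rw [List.take_of_length_le h]; omega
  have zend : ∀ k, M.length ≤ k → hgt M k = t - s := by
    intro k h
    unfold hgt
    rw [List.take_of_length_le h]; omega
  -- heights
  have hsame : ∀ k, d - s ≤ k → k ≤ d + M.length + t →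
      hgt (hatPath d (s + 1) (t + 1) M) k = hgt (hatPath d s t M) k + 1 := by
    intro k a b
    rw [g1, g2]
    rw [show k - (d - s) - s = k - d by omega, show k - (d - (s + 1)) - (s + 1) = k - d by omega]
    omega
  have hge : ∀ k, d - s ≤ k → k ≤ d + M.length + t →
      1 ≤ hgt (hatPath d (s + 1) (t + 1) M) k := by
    intro k a b
    rw [g2, show k - (d - (s + 1)) - (s + 1) = k - d by omega]
    have := zpos (k - d)
    rcases lt_trichotomy k d with h | h | h
    · rw [show k - d = 0 by omega, z0]; omega
    · rw [show k - d = 0 by omega, z0]; omega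
    · rcases le_total (k - d) M.length with h' | h'
      · omega
      · have := zend _ h'
        omega
  have hlast : hgt (hatPath d (s + 1) (t + 1) M) (d + M.length + t + 1) = 0 := by
    rw [g2, zend _ (by omega)]; omega
  have hlast2 : hgt (hatPath d (s + 1) (t + 1) M) (d + M.length + t - 1) = 2 := by
    rw [g2, zend _ (by omega)]; omega
  have hfirst : ∀ k, k ≤ d → hgt (hatPath d (s + 1) (t + 1) M) k
      = (k - (d - (s + 1)) : ℕ) := by
    intro k hk
    rw [g2, show k - (d - (s + 1)) - (s + 1) = 0 by omega, z0]; omega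
  have posU : ∀ i, (hatPath d (s + 1) (t + 1) M)[i]? = some DStep.U → d - (s + 1) ≤ i := by
    intro i a
    by_contra hc
    rw [h2, if_pos (by omega)] at a
    simp at a
  have posD : ∀ i, (hatPath d (s + 1) (t + 1) M)[i]? = some DStep.D →
      i < d + M.length + t + 1 := by
    intro i b
    by_contra hc
    rw [h2, if_neg (by omega), if_neg (by omega), if_neg (by omega), if_neg (by omega)] at b
    split_ifs at b <;> simp at b
  have stepH : ∀ (w : List DStep) i x, w[i]? = some x → hgt w (i + 1) = hgt w i + x.val := by
    intro w i x hx
    unfold hgt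
    rw [List.take_add_one, hx, stepSum_append]
    simp [stepSum]
  rw [hasLambda_iff, hasLambda_iff]
  constructor
  · rintro ⟨i, j, hi, hi', hij, hj, hj', m1, m2, h3, h4⟩
    have pi := posU i hi
    have pj := posD _ hj'
    have s1 := stepH _ _ _ hi
    have s2 := stepH _ _ _ hi'
    have s3 := stepH _ _ _ hj
    have s4 := stepH _ _ _ hj'
    simp only [DStep.val] at s1 s2 s3 s4
    rw [show i + 1 + 1 = i + 2 by omega] at s2
    rw [show j + 1 + 1 = j + 2 by omega] at s4
    by_cases hA : i = d - (s + 1)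
    · right
      have f := hfirst (i + 2) (by omega)
      have hj2 : j + 2 = d + M.length + t + 1 := by
        by_contra hc
        have := hge (j + 2) (by omega) (by omega)
        omega
      intro k hk
      have := h4 (d + k) (by omega) (by omega)
      rw [g2 (d + k)] at this
      rw [show d + k - (d - (s + 1)) - (s + 1) = k by omega] at this
      unfold hgt at this f
      omega
    · by_cases hB : j + 2 = d + M.length + t + 1
      · exfalso
        have := hge i (by omega) (by omega)
        rw [hB] at s4
        omega
      · left
        refine ⟨i, j, ?_, ?_, hij, ?_, ?_, m1, m2, ?_, ?_⟩
        · rw [← same _ (by omega) (by omega), hi]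
        · rw [← same _ (by omega) (by omega), hi']
        · rw [← same _ (by omega) (by omega), hj]
        · rw [← same _ (by omega) (by omega), hj']
        · have := hsame j (by omega) (by omega)
          have := hsame (i + 2) (by omega) (by omega)
          omega
        · intro k k1 k2
          have := h4 k k1 k2
          have := hsame k (by omega) (by omega)
          have := hsame (i + 2) (by omega) (by omega)
          omega
  · rintro (⟨i, j, hi, hi', hij, hj, hj', m1, m2, h3, h4⟩ | hp)
    · have pi : d - s ≤ i := by
        by_contra hc
        rw [h1, if_pos (by omega)] at hi
        simp at hi
      have pj : j + 1 < d + M.length + t := by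
        by_contra hc
        rw [h1, if_neg (by omega), if_neg (by omega), if_neg (by omega),
          if_neg (by omega)] at hj'
        split_ifs at hj' <;> simp at hj'
      refine ⟨i, j, ?_, ?_, hij, ?_, ?_, m1, m2, ?_, ?_⟩
      · rw [same _ (by omega) (by omega), hi]
      · rw [same _ (by omega) (by omega), hi']
      · rw [same _ (by omega) (by omega), hj]
      · rw [same _ (by omega) (by omega), hj']
      · have := hsame j (by omega) (by omega)
        have := hsame (i + 2) (by omega) (by omega)
        omega
      · intro k k1 k2
        have := h4 k k1 k2
        have := hsame k (by omega) (by omega)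
        have := hsame (i + 2) (by omega) (by omega)
        omega
    · have f := hfirst (d - (s + 1) + 2) (by omega)
      refine ⟨d - (s + 1), d + M.length + t - 1, ?_, ?_, by omega, ?_, ?_, ?_, ?_, ?_, ?_⟩
      · rw [h2, if_neg (by omega), if_pos (by omega)]
      · rw [h2, if_neg (by omega), if_pos (by omega)]
      · rw [h2, if_neg (by omega), if_neg (by omega), if_neg (by omega), if_pos (by omega)]
      · rw [h2, if_neg (by omega), if_neg (by omega), if_neg (by omega), if_pos (by omega)]
      · rw [Nat.mod_eq_of_lt (by omega)]; omega
      · rw [hlen, show d + d * n + t - 1 + 1 = t + d * (n + 1) by rw [mul_add]; omega,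
          Nat.add_mul_mod_self_left, Nat.mod_eq_of_lt htd]
        omega
      · rw [hlast2, f]; omega
      · intro k k1 k2
        rw [f, g2, show k - (d - (s + 1)) - (s + 1) = k - d by omega]
        rcases le_total k d with h | h
        · rw [show k - d = 0 by omega, z0]; omega
        · rcases le_total (k - d) M.length with h' | h'
          · have := hp _ h'
            unfold hgt
            omega
          · have := zend _ h'
            omega

theorem prime_succ_iff (m d n s t : ℕ) (hs : 1 ≤ s) (ht : 1 ≤ t) (hsd : s < d) (htd : t < d)
    (M : List DStep) : IsPrimePath m d n (s + 1) (t + 1) M ↔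
      (IsGoodPath m d n s t M ∧ ¬ IsPrimePath m d n s t M) := by
  have hS := short_hat m d s t hs ht hsd htd M
  constructor
  · rintro ⟨⟨⟨a1, a2, a3, a4⟩, b, c⟩, e⟩
    have a3' : (s : ℤ) + stepSum M = t := by push_cast at a3; omega
    have a4' : ∀ k ≤ M.length, 0 ≤ (s : ℤ) + stepSum (M.take k) := by
      intro k hk
      have := e k hk
      push_cast at this; omega
    rw [lambda_hat d n s t hs ht hsd htd M a1 a3' a4', not_or] at c
    exact ⟨⟨⟨a1, a2, a3', a4'⟩, fun h => b (hS.2 h), c.1⟩, fun h => c.2 h.2⟩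
  · rintro ⟨⟨⟨a1, a2, a3, a4⟩, b, c⟩, e⟩
    have hL := lambda_hat d n s t hs ht hsd htd M a1 a3 a4
    refine ⟨⟨⟨a1, a2, by push_cast; omega, ?_⟩, fun h => b (hS.1 h), ?_⟩, ?_⟩
    · intro k hk
      have := a4 k hk
      push_cast; omega
    · rw [hL, not_or]
      exact ⟨c, fun h => e ⟨⟨⟨a1, a2, a3, a4⟩, b, c⟩, h⟩⟩
    · intro k hk
      have := a4 k hk
      push_cast; omega

theorem count_succ (m d n s t : ℕ) (hs : 1 ≤ s) (ht : 1 ≤ t) (hsd : s < d) (htd : t < d) :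
    aCount m d n (s + 1) (t + 1) + aCount m d n s t = gCount m d n s t := by
  unfold aCount gCount
  have : {M | IsPrimePath m d n (s + 1) (t + 1) M}
      = {M | IsGoodPath m d n s t M} \ {M | IsPrimePath m d n s t M} := by
    ext M
    exact prime_succ_iff m d n s t hs ht hsd htd M
  rw [this]
  refine Set.ncard_sdiff_add_ncard_of_subset (fun M h => h.1) ?_
  exact (finite_words (d * n)).subset fun M h => h.1.1

theorem stmt9 (m d s t : ℕ) (hm : 1 ≤ m) (hd : 2 ≤ d) (ht : 2 ≤ t) (hts : t ≤ s)
    (hsd : s ≤ d) :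
    (∀ n : ℕ,
      aCount m d n s t + aCount m d n (s - 1) (t - 1) = gCount m d n (s - 1) (t - 1)) ∧
    Aps m d s t = Gps m d (s - 1) (t - 1) - Aps m d (s - 1) (t - 1) := by
  obtain ⟨s, rfl⟩ : ∃ r, s = r + 1 := ⟨s - 1, by omega⟩
  obtain ⟨t, rfl⟩ : ∃ r, t = r + 1 := ⟨t - 1, by omega⟩
  have key : ∀ n : ℕ, aCount m d n (s + 1) (t + 1) + aCount m d n s t = gCount m d n s t :=
    fun n => count_succ m d n s t (by omega) (by omega) (by omega) (by omega)
  simp only [Nat.add_sub_cancel]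
  refine ⟨key, ?_⟩
  ext N
  simp only [Aps, Gps, map_sub, PowerSeries.coeff_mk]
  split_ifs
  · have := key (N / d)
    omega
  · simp
end

section
/- For all integers m ≥ 1, d ≥ 1 and every 1 ≤ t ≤ s ≤ d, the following identity of formal power series over ℤ holds: A^{⟨s,t⟩}_{m,d}(x) = (−1)^t δ_{s,t} C_{m,d}(x) + Σ_{i=0}^{t−1} (−1)^{t−i+1} G^{⟨s−t+i,i⟩}_{m,d}(x), where δ_{s,t} = 1 if s = t and 0 otherwise and C_{m,d}(x) = Σ_{k=0}^{m−2} x^{dk}. -/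
namespace Stmt10

open DStep List

lemma stepSum_append (u v : List DStep) : stepSum (u ++ v) = stepSum u + stepSum v := by
  simp [stepSum]

lemma stepSum_cons (u : DStep) (v : List DStep) : stepSum (u :: v) = u.val + stepSum v := by
  simp [stepSum]

lemma stepSum_nil : stepSum [] = 0 := by simp [stepSum]

lemma stepSum_U (n : ℕ) : stepSum (replicate n U) = n := by simp [stepSum, DStep.val]
lemma stepSum_D (n : ℕ) : stepSum (replicate n D) = -n := by simp [stepSum, DStep.val]
lemma stepSum_L (n : ℕ) : stepSum (replicate n L) = 0 := by simp [stepSum, DStep.val]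

/-- prefixes have nonnegative height -/
lemma nonneg_iff (c : ℤ) (P : List DStep) :
    (∀ k ≤ P.length, 0 ≤ c + stepSum (P.take k)) ↔ ∀ u v, P = u ++ v → 0 ≤ c + stepSum u := by
  constructor
  · rintro h u v rfl
    have := h u.length (by simp)
    simpa using this
  · intro h k _
    exact h _ (P.drop k) (by simp)

lemma nonneg_wrap (i j : ℕ) (M : List DStep) (hs : (i : ℤ) + stepSum M = j) :
    (∀ k ≤ (replicate i U ++ M ++ replicate j D).length,
      0 ≤ stepSum ((replicate i U ++ M ++ replicate j D).take k)) ↔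
    (∀ k ≤ M.length, 0 ≤ (i : ℤ) + stepSum (M.take k)) := by
  have h0 := nonneg_iff 0 (replicate i U ++ M ++ replicate j D)
  simp only [zero_add] at h0
  rw [h0, nonneg_iff]
  constructor
  · rintro h u v rfl
    have := h (replicate i U ++ u) (v ++ replicate j D) (by simp)
    rwa [stepSum_append, stepSum_U] at this
  · intro h u v huv
    rw [append_assoc, append_eq_append_iff] at huv
    rcases huv with ⟨w, rfl, hw⟩ | ⟨w, hw, rfl⟩
    · rw [append_eq_append_iff] at hw
      rcases hw with ⟨z, rfl, hz⟩ | ⟨z, rfl, rfl⟩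
      · have hz' := hz.symm
        rw [append_eq_replicate_iff] at hz'
        obtain ⟨h1, h2, h3⟩ := hz'
        rw [h2]
        simp only [stepSum_append, stepSum_U, stepSum_D]
        have : z.length ≤ j := by omega
        have : (z.length : ℤ) ≤ j := by exact_mod_cast this
        linarith
      · rw [stepSum_append, stepSum_U]
        exact h w z rfl
    · have hz' := hw.symm
      rw [append_eq_replicate_iff] at hz'
      obtain ⟨h1, h2, h3⟩ := hz'
      rw [h2, stepSum_U]; positivity

lemma strip_left (a : ℕ) : ∀ (Y p R : List DStep), replicate a L ++ Y = p ++ U :: R →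
    ∃ p', p = replicate a L ++ p' ∧ Y = p' ++ U :: R := by
  induction a with
  | zero => intro Y p R h; exact ⟨p, by simp, by simpa using h⟩
  | succ a ih =>
    intro Y p R h
    rw [replicate_succ, cons_append] at h
    cases p with
    | nil => simp at h
    | cons x p =>
      simp only [cons_append, cons.injEq] at h
      obtain ⟨p', rfl, h2⟩ := ih Y p R h.2
      exact ⟨p', by simp [replicate_succ, h.1], h2⟩

lemma strip_right (b : ℕ) : ∀ (Y q R : List DStep), Y ++ replicate b L = R ++ D :: q →
    ∃ q', q = q' ++ replicate b L ∧ Y = R ++ D :: q' := by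
  induction b with
  | zero => intro Y q R h; exact ⟨q, by simp, by simpa using h⟩
  | succ b ih =>
    intro Y q R h
    rw [replicate_succ', ← append_assoc] at h
    rcases q.eq_nil_or_concat with rfl | ⟨q0, x, rfl⟩
    · have := append_inj' h (by simp)
      simp at this
    · have h' : (Y ++ replicate b L) ++ [L] = (R ++ D :: q0) ++ [x] := by simpa using h
      obtain ⟨h1, h2⟩ := append_inj' h' (by simp)
      obtain ⟨q', rfl, h3⟩ := ih Y q0 R h1
      refine ⟨q', ?_, h3⟩
      rw [replicate_succ']
      simp at h2
      simp [← h2]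

lemma strip (a b : ℕ) (Y p Z q : List DStep)
    (h : replicate a L ++ Y ++ replicate b L = p ++ U :: Z ++ D :: q) :
    ∃ p' q', p = replicate a L ++ p' ∧ q = q' ++ replicate b L ∧ Y = p' ++ U :: Z ++ D :: q' := by
  obtain ⟨q', hq, h1⟩ := strip_right _ _ _ _ h
  obtain ⟨p', hp, h2⟩ := strip_left a Y p (Z ++ D :: q') (by simpa using h1)
  exact ⟨p', q', hp, hq, by simpa using h2⟩

/-- the two completed words -/
def W1 (a b : ℕ) (X : List DStep) : List DStep :=
  replicate a L ++ (U :: (X ++ [D])) ++ replicate b L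
def W0 (a b : ℕ) (X : List DStep) : List DStep :=
  replicate (a + 1) L ++ X ++ replicate (b + 1) L

lemma occ_zero (a b : ℕ) (X p Z q : List DStep) (h : W0 a b X = p ++ U :: Z ++ D :: q) :
    ∃ p' q', p'.length = p.length ∧ W1 a b X = p' ++ U :: Z ++ D :: q' := by
  obtain ⟨p', q', rfl, rfl, rfl⟩ := strip _ _ _ _ _ _ h
  exact ⟨replicate a L ++ U :: p', q' ++ D :: replicate b L, by simp; omega, by simp [W1]⟩

lemma occ_one (a b : ℕ) (X p Z q : List DStep) (hX : ∀ u v, X = u ++ v → 0 ≤ stepSum u)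
    (hX0 : stepSum X = 0) (hZ : stepSum Z = 0) (h : W1 a b X = p ++ U :: Z ++ D :: q) :
    (X = Z ∧ p.length = a) ∨
    ∃ p' q', p'.length = p.length ∧ W0 a b X = p' ++ U :: Z ++ D :: q' := by
  obtain ⟨p', q', rfl, rfl, hY⟩ := strip _ _ _ _ _ _ h
  clear h
  have h := hY
  clear hY
  cases p' with
  | nil =>
    left
    refine ⟨?_, by simp⟩
    rcases q'.eq_nil_or_concat with rfl | ⟨q0, x, rfl⟩
    · simpa using h
    · exfalso
      have h' : X ++ [D] = (Z ++ D :: q0) ++ [x] := by simpa using h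
      obtain ⟨h1, h2⟩ := append_inj' h' (by simp)
      have := hX (Z ++ [D]) q0 (by simp [h1])
      simp [stepSum_append, stepSum_cons, stepSum_nil, hZ, DStep.val] at this
  | cons y p0 =>
    right
    simp only [cons_append, cons.injEq] at h
    obtain ⟨rfl, h⟩ := h
    rcases q'.eq_nil_or_concat with rfl | ⟨q0, x, rfl⟩
    · exfalso
      obtain ⟨h1, h2⟩ := append_inj' h (by simp)
      have := hX p0 (U :: Z) h1
      rw [h1] at hX0
      simp [stepSum_append, stepSum_cons, hZ, DStep.val] at hX0
      omega
    · have h' : X ++ [D] = (p0 ++ U :: Z ++ D :: q0) ++ [x] := by simpa using h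
      obtain ⟨h1, h2⟩ := append_inj' h' (by simp)
      exact ⟨replicate (a + 1) L ++ p0, q0 ++ replicate (b + 1) L, by simp; omega,
        by simp [W0, h1]⟩

lemma short_iff (m d a b : ℕ) (X : List DStep) (hX : ∀ u v, X = u ++ v → 0 ≤ stepSum u)
    (hX0 : stepSum X = 0) :
    HasShortUD m d (W1 a b X) ↔
      HasShortUD m d (W0 a b X) ∨ ∃ k, k + 2 ≤ m ∧ X = replicate (k * d) L := by
  constructor
  · rintro ⟨k, hk, p, q, h⟩
    rcases occ_one a b X p (replicate (k * d) L) q hX hX0 (stepSum_L _)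
      (by rw [← h]; simp) with ⟨h1, -⟩ | ⟨p', q', -, h1⟩
    · exact Or.inr ⟨k, hk, h1⟩
    · exact Or.inl ⟨k, hk, p', q', by rw [h1]; simp⟩
  · rintro (⟨k, hk, p, q, h⟩ | ⟨k, hk, h⟩)
    · obtain ⟨p', q', -, h1⟩ := occ_zero a b X p (replicate (k * d) L) q (by rw [← h]; simp)
      exact ⟨k, hk, p', q', by rw [h1]; simp⟩
    · exact ⟨k, hk, replicate a L, replicate b L, by simp [W1, h]⟩

lemma lambda_iff (d a b : ℕ) (X : List DStep) (hX : ∀ u v, X = u ++ v → 0 ≤ stepSum u)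
    (hX0 : stepSum X = 0) :
    HasLambda d (W1 a b X) ↔
      HasLambda d (W0 a b X) ∨ ∃ P, X = U :: (P ++ [D]) ∧ (a + 1) % d ≠ 0 ∧
        (a + P.length + 3) % d ≠ 0 ∧ (∀ k ≤ P.length, 0 ≤ stepSum (P.take k)) := by
  constructor
  · rintro ⟨p, P, q, h, h1, h2, h3, h4⟩
    rcases occ_one a b X p (U :: (P ++ [D])) q hX hX0
      (by simp [stepSum_append, stepSum_cons, stepSum_nil, DStep.val, h3])
      (by rw [h]; simp) with ⟨h5, h6⟩ | ⟨p', q', h5, h6⟩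
    · exact Or.inr ⟨P, h5, by rwa [← h6], by rwa [← h6], h4⟩
    · exact Or.inl ⟨p', P, q', by rw [h6]; simp, by rwa [h5], by rwa [h5], h3, h4⟩
  · rintro (⟨p, P, q, h, h1, h2, h3, h4⟩ | ⟨P, h, h1, h2, h4⟩)
    · obtain ⟨p', q', h5, h6⟩ := occ_zero a b X p (U :: (P ++ [D])) q (by rw [h]; simp)
      exact ⟨p', P, q', by rw [h6]; simp, by rwa [h5], by rwa [h5], h3, h4⟩
    · refine ⟨replicate a L, P, replicate b L, by simp [W1, h], by simpa using h1,
        by simpa using h2, ?_, h4⟩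
      rw [h] at hX0
      simpa [stepSum_append, stepSum_cons, stepSum_nil, DStep.val] using hX0

lemma hat_one (d s t : ℕ) (M : List DStep) :
    hatPath d (s + 1) (t + 1) M =
      W1 (d - (s + 1)) (d - (t + 1)) (replicate s U ++ M ++ replicate t D) := by
  simp only [hatPath, W1]
  rw [replicate_succ, replicate_succ']
  simp

lemma hat_zero (d s t : ℕ) (hs : s + 1 ≤ d) (ht : t + 1 ≤ d) (M : List DStep) :
    hatPath d s t M =
      W0 (d - (s + 1)) (d - (t + 1)) (replicate s U ++ M ++ replicate t D) := by
  simp only [hatPath, W0]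
  rw [show d - (s + 1) + 1 = d - s by omega, show d - (t + 1) + 1 = d - t by omega]
  simp

lemma prime_iff (m d n s t : ℕ) (hs : s + 1 ≤ d) (ht : t + 1 ≤ d) (M : List DStep) :
    IsPrimePath m d n (s + 1) (t + 1) M ↔ IsGoodPath m d n s t M ∧
      (¬ ∃ k, k + 2 ≤ m ∧ replicate s U ++ M ++ replicate t D = replicate (k * d) L) ∧
      ¬ ∃ P, replicate s U ++ M ++ replicate t D = U :: (P ++ [D]) ∧ (d - (s + 1) + 1) % d ≠ 0 ∧
        (d - (s + 1) + P.length + 3) % d ≠ 0 ∧ (∀ k ≤ P.length, 0 ≤ stepSum (P.take k)) := by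
  have hdlu : (IsDLUPath d n (s + 1) (t + 1) M ∧
      ∀ k ≤ M.length, 0 < ((s + 1 : ℕ) : ℤ) + stepSum (M.take k)) ↔ IsDLUPath d n s t M := by
    unfold IsDLUPath
    push_cast
    constructor
    · rintro ⟨⟨h1, h2, h3, h4⟩, h5⟩
      refine ⟨h1, h2, by omega, fun k hk => ?_⟩
      have := h5 k hk; omega
    · rintro ⟨h1, h2, h3, h4⟩
      refine ⟨⟨h1, h2, by omega, fun k hk => ?_⟩, fun k hk => ?_⟩
      · have := h4 k hk; omega
      · have := h4 k hk; omega
  have key : IsDLUPath d n s t M →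
      ((RegularWord m d (hatPath d (s + 1) (t + 1) M) ∧
        ¬ HasLambda d (hatPath d (s + 1) (t + 1) M)) ↔
      ((RegularWord m d (hatPath d s t M) ∧ ¬ HasLambda d (hatPath d s t M)) ∧
      (¬ ∃ k, k + 2 ≤ m ∧ replicate s U ++ M ++ replicate t D = replicate (k * d) L) ∧
      ¬ ∃ P, replicate s U ++ M ++ replicate t D = U :: (P ++ [D]) ∧ (d - (s + 1) + 1) % d ≠ 0 ∧
        (d - (s + 1) + P.length + 3) % d ≠ 0 ∧ (∀ k ≤ P.length, 0 ≤ stepSum (P.take k)))) := by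
    rintro ⟨h1, h2, h3, h4⟩
    have hn := (nonneg_wrap s t M h3).2 h4
    have hn' := nonneg_iff 0 (replicate s U ++ M ++ replicate t D)
    simp only [zero_add] at hn'
    rw [hn'] at hn
    have h0 : stepSum (replicate s U ++ M ++ replicate t D) = 0 := by
      simp only [stepSum_append, stepSum_U, stepSum_D]; omega
    rw [hat_one, hat_zero d s t hs ht]
    unfold RegularWord
    rw [short_iff _ _ _ _ _ hn h0, lambda_iff _ _ _ _ hn h0, not_or, not_or]
    exact and_and_and_comm
  unfold IsPrimePath IsGoodPath
  tauto

lemma fin_good (m d n s t : ℕ) : {M | IsGoodPath m d n s t M}.Finite := by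
  have : Finite DStep := Finite.of_surjective
    (fun i : Fin 3 => if i = 0 then U else if i = 1 then D else L)
    (by intro x; cases x; exacts [⟨0, by simp⟩, ⟨1, by simp⟩, ⟨2, by simp⟩])
  exact (List.finite_length_eq DStep (d * n)).subset fun M h => h.1.1

lemma count_step (m d n s t : ℕ) (hs : s + 2 ≤ d) (ht : t + 2 ≤ d) :
    aCount m d n (s + 2) (t + 2) + aCount m d n (s + 1) (t + 1) = gCount m d n (s + 1) (t + 1) := by
  have : {M | IsPrimePath m d n (s + 2) (t + 2) M} =
      {M | IsGoodPath m d n (s + 1) (t + 1) M} \ {M | IsPrimePath m d n (s + 1) (t + 1) M} := by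
    ext M
    simp only [Set.mem_setOf_eq, Set.mem_diff]
    rw [prime_iff m d n (s + 1) (t + 1) hs ht]
    refine and_congr_right fun hg => ?_
    obtain ⟨h1, h2, h3, h4⟩ := hg.1
    push_cast at h3
    have hX : replicate (s + 1) U ++ M ++ replicate (t + 1) D
        = U :: ((replicate s U ++ M ++ replicate t D) ++ [D]) := by
      rw [replicate_succ, replicate_succ']; simp
    have hno : ¬ ∃ k, k + 2 ≤ m ∧
        replicate (s + 1) U ++ M ++ replicate (t + 1) D = replicate (k * d) L := by
      rintro ⟨k, -, h⟩
      have : U ∈ replicate (k * d) L := by rw [← h, hX]; simp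
      simp at this
    have hmod1 : (d - (s + 1 + 1) + 1) % d ≠ 0 := by
      rw [Nat.mod_eq_of_lt (by omega)]; omega
    have hmod2 : (d - (s + 1 + 1) + (replicate s U ++ M ++ replicate t D).length + 3) % d ≠ 0 := by
      have : d - (s + 1 + 1) + (replicate s U ++ M ++ replicate t D).length + 3
          = t + 1 + d * (n + 1) := by
        simp [h1, mul_add]; omega
      rw [this, Nat.add_mul_mod_self_left, Nat.mod_eq_of_lt (by omega)]; omega
    have hw := nonneg_wrap s t M (by omega)
    have hpr : IsPrimePath m d n (s + 1) (t + 1) M ↔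
        ∀ k ≤ (replicate s U ++ M ++ replicate t D).length,
          0 ≤ stepSum ((replicate s U ++ M ++ replicate t D).take k) := by
      rw [hw]
      unfold IsPrimePath
      constructor
      · rintro ⟨-, h⟩ k hk
        have := h k hk
        push_cast at this; omega
      · intro h
        refine ⟨hg, fun k hk => ?_⟩
        have := h k hk
        push_cast; omega
    rw [hpr]
    constructor
    · rintro ⟨-, h⟩ h'
      exact h ⟨_, hX, hmod1, hmod2, h'⟩
    · intro h
      refine ⟨hno, ?_⟩
      rintro ⟨P, hP, -, -, h'⟩
      rw [hX] at hP
      simp only [cons.injEq, true_and] at hP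
      rw [append_cancel_right hP] at h
      exact h h'
  unfold aCount gCount
  rw [this]
  exact Set.ncard_diff_add_ncard_of_subset (fun M h => h.1) (fin_good ..)

lemma good_L (m d n : ℕ) : IsGoodPath m d n 0 0 (replicate (d * n) L) := by
  have hh : hatPath d 0 0 (replicate (d * n) L) = replicate (d + d * n + d) L := by
    simp [hatPath]
  refine ⟨⟨by simp, ?_, by simp [stepSum_L], ?_⟩, ?_, ?_⟩
  · intro i hi
    refine ⟨0, d, 0, by simp, ?_⟩
    have : d * (i + 1) ≤ d * n := Nat.mul_le_mul_left _ hi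
    rw [mul_add] at this
    simp [drop_replicate, take_replicate]
    omega
  · intro k _
    simp [take_replicate, stepSum_L]
  · rintro ⟨k, -, p, q, h⟩
    rw [hh] at h
    have : U ∈ replicate (d + d * n + d) L := by rw [← h]; simp
    simp at this
  · rintro ⟨p, P, q, h, -⟩
    rw [hh] at h
    have : U ∈ replicate (d + d * n + d) L := by rw [h]; simp
    simp at this

lemma count_base (m d n s : ℕ) (hs : s + 1 ≤ d) :
    aCount m d n (s + 1) 1 + (if s = 0 ∧ n + 2 ≤ m then 1 else 0) = gCount m d n s 0 := by
  have hp : ∀ M, IsPrimePath m d n (s + 1) 1 M ↔ IsGoodPath m d n s 0 M ∧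
      ¬ (s = 0 ∧ n + 2 ≤ m ∧ M = replicate (d * n) L) := by
    intro M
    have := prime_iff m d n s 0 hs (by omega) M
    rw [zero_add] at this
    rw [this]
    refine and_congr_right fun hg => ?_
    have hl : M.length = d * n := hg.1.1
    have hnoP : ¬ ∃ P, replicate s U ++ M ++ replicate 0 D = U :: (P ++ [D]) ∧
        (d - (s + 1) + 1) % d ≠ 0 ∧
        (d - (s + 1) + P.length + 3) % d ≠ 0 ∧ (∀ k ≤ P.length, 0 ≤ stepSum (P.take k)) := by
      rintro ⟨P, hP, -, h, -⟩
      have hlen := congrArg length hP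
      simp [hl] at hlen
      apply h
      have : d - (s + 1) + P.length + 3 = d * (n + 1) := by rw [mul_add]; omega
      rw [this]; simp
    have hk : (∃ k, k + 2 ≤ m ∧ replicate s U ++ M ++ replicate 0 D = replicate (k * d) L) ↔
        (s = 0 ∧ n + 2 ≤ m ∧ M = replicate (d * n) L) := by
      constructor
      · rintro ⟨k, hk, h⟩
        have hs0 : s = 0 := by
          by_contra hne
          have : U ∈ replicate (k * d) L := by rw [← h]; simp [hne]
          simp at this
        subst hs0
        simp at h
        have : k = n := by
          have h2 := hl
          rw [h, length_replicate, mul_comm] at h2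
          exact Nat.eq_of_mul_eq_mul_left (by omega) h2
        subst this
        exact ⟨rfl, hk, by rw [h, mul_comm]⟩
      · rintro ⟨rfl, h, hM⟩
        exact ⟨n, h, by simp [hM, mul_comm]⟩
    rw [hk]
    tauto
  unfold aCount gCount
  split_ifs with hc
  · obtain ⟨rfl, hm⟩ := hc
    have : {M | IsPrimePath m d n (0 + 1) 1 M} =
        {M | IsGoodPath m d n 0 0 M} \ {replicate (d * n) L} := by
      ext M
      simp only [Set.mem_setOf_eq, Set.mem_diff, Set.mem_singleton_iff]
      rw [hp]; tauto
    rw [this]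
    exact Set.ncard_diff_singleton_add_one (good_L m d n) (fin_good ..)
  · have : {M | IsPrimePath m d n (s + 1) 1 M} = {M | IsGoodPath m d n s 0 M} := by
      ext M
      simp only [Set.mem_setOf_eq]
      rw [hp]; tauto
    rw [this]; simp

lemma coeff_C (m d N : ℕ) (hd : 1 ≤ d) :
    PowerSeries.coeff N (Cps m d) = if d ∣ N then (if N / d + 2 ≤ m then 1 else 0) else 0 := by
  unfold Cps
  simp only [map_sum, PowerSeries.coeff_X_pow]
  split_ifs with h h2
  · obtain ⟨q, rfl⟩ := h
    rw [Nat.mul_div_cancel_left _ (by omega)] at h2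
    rw [Finset.sum_eq_single q]
    · simp
    · intro b _ hb
      rw [if_neg]
      intro h
      exact hb (Nat.eq_of_mul_eq_mul_left (by omega) h).symm
    · intro h
      simp at h; omega
  · obtain ⟨q, rfl⟩ := h
    rw [Nat.mul_div_cancel_left _ (by omega)] at h2
    refine Finset.sum_eq_zero fun k hk => if_neg fun h => ?_
    have := Nat.eq_of_mul_eq_mul_left (by omega) h
    simp at hk; omega
  · exact Finset.sum_eq_zero fun k _ => if_neg fun h' => h ⟨k, h'⟩

lemma ps_step (m d s t : ℕ) (hs : s + 2 ≤ d) (ht : t + 2 ≤ d) :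
    Aps m d (s + 2) (t + 2) = Gps m d (s + 1) (t + 1) - Aps m d (s + 1) (t + 1) := by
  rw [eq_sub_iff_add_eq]
  ext N
  simp only [Aps, Gps, map_add, PowerSeries.coeff_mk]
  split_ifs
  · exact_mod_cast count_step m d (N / d) s t hs ht
  · simp

lemma ps_base (m d s : ℕ) (hs : s + 1 ≤ d) :
    Aps m d (s + 1) 1 = Gps m d s 0 - if s = 0 then Cps m d else 0 := by
  rw [eq_sub_iff_add_eq]
  ext N
  have := count_base m d (N / d) s hs
  by_cases h0 : s = 0
  · simp only [h0, if_true, Aps, Gps, map_add, PowerSeries.coeff_mk, coeff_C m d N (by omega)]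
    simp only [h0, true_and] at this
    split_ifs with h1 h2
    · rw [if_pos h2] at this; exact_mod_cast this
    · rw [if_neg h2] at this; exact_mod_cast this
    · simp
  · simp only [h0, if_false, Aps, Gps, map_add, PowerSeries.coeff_mk]
    simp only [h0, false_and, if_false] at this
    split_ifs
    · simp; exact_mod_cast this
    · simp

lemma main (m d t r : ℕ) (h : r + t + 1 ≤ d) :
    Aps m d (r + t + 1) (t + 1) =
      (if r = 0 then (-1 : PowerSeries ℤ) ^ (t + 1) * Cps m d else 0) +
      ∑ i ∈ Finset.range (t + 1), (-1 : PowerSeries ℤ) ^ (t + 1 - i + 1) * Gps m d (r + i) i := by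
  induction t with
  | zero =>
    rw [add_zero, zero_add, ps_base m d r (by omega)]
    split_ifs <;> simp <;> ring
  | succ t ih =>
    have hstep := ps_step m d (r + t) t (by omega) (by omega)
    rw [show r + (t + 1) + 1 = r + t + 2 by ring, show t + 1 + 1 = t + 2 by ring, hstep,
      ih (by omega), Finset.sum_range_succ _ (t + 1)]
    have : ∑ i ∈ Finset.range (t + 1), (-1 : PowerSeries ℤ) ^ (t + 2 - i + 1) * Gps m d (r + i) i
        = - ∑ i ∈ Finset.range (t + 1),
          (-1 : PowerSeries ℤ) ^ (t + 1 - i + 1) * Gps m d (r + i) i := by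
      rw [← Finset.sum_neg_distrib]
      refine Finset.sum_congr rfl fun i hi => ?_
      simp at hi
      rw [show t + 2 - i + 1 = (t + 1 - i + 1) + 1 by omega, pow_succ]
      ring
    rw [this, show t + 2 - (t + 1) + 1 = 2 by omega, ← add_assoc r t 1]
    split_ifs <;> ring

end Stmt10

theorem stmt10 (m d s t : ℕ) (hm : 1 ≤ m) (hd : 1 ≤ d) (ht : 1 ≤ t) (hts : t ≤ s)
    (hsd : s ≤ d) :
    Aps m d s t =
      (if s = t then (-1 : PowerSeries ℤ) ^ t * Cps m d else 0) +
      ∑ i ∈ Finset.range t, (-1 : PowerSeries ℤ) ^ (t - i + 1) * Gps m d (s - t + i) i := by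
  obtain ⟨t, rfl⟩ : ∃ t', t = t' + 1 := ⟨t - 1, by omega⟩
  obtain ⟨r, rfl⟩ : ∃ r, s = r + t + 1 := ⟨s - (t + 1), by omega⟩
  rw [Stmt10.main m d t r hsd, show r + t + 1 - (t + 1) = r by omega]
  simp only [add_assoc, add_eq_right]
end

section
/- For all integers m ≥ 1, d ≥ 1 and every 1 ≤ s ≤ d, 0 ≤ t ≤ s, the following identity of formal power series over ℤ holds: G^{⟨s,t⟩}_{m,d}(x) = A^{⟨s,t⟩}_{m,d}(x) + x^d Σ_{a=1}^{d} Σ_{c=0}^{d−a} A^{⟨max(s,a),min(s,a)⟩}_{m,d}(x) · G^{⟨c,t⟩}_{m,d}(x), where by convention A^{⟨s,0⟩}_{m,d}(x) = 0 for s ≥ 1 (a path ending on the x-axis necessarily touches it). -/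
namespace DLUAux

open DStep

instance : Fintype DStep := ⟨{U, D, L}, by intro x; cases x <;> simp⟩

@[simp] lemma stepSum_nil : stepSum [] = 0 := by simp [stepSum]
@[simp] lemma stepSum_cons (x : DStep) (w : List DStep) :
    stepSum (x :: w) = x.val + stepSum w := by simp [stepSum]
@[simp] lemma stepSum_append (v w : List DStep) :
    stepSum (v ++ w) = stepSum v + stepSum w := by simp [stepSum]
@[simp] lemma stepSum_replicate (n : ℕ) (x : DStep) :
    stepSum (List.replicate n x) = n * x.val := by simp [stepSum]
@[simp] lemma val_U : DStep.U.val = 1 := rfl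
@[simp] lemma val_D : DStep.D.val = -1 := rfl
@[simp] lemma val_L : DStep.L.val = 0 := rfl

/-- Heights stay nonnegative when starting at height `h`. -/
def NN (h : ℤ) (w : List DStep) : Prop := ∀ k ≤ w.length, 0 ≤ h + stepSum (w.take k)

/-- Heights stay positive when starting at height `h`. -/
def PP (h : ℤ) (w : List DStep) : Prop := ∀ k ≤ w.length, 0 < h + stepSum (w.take k)

lemma PP.nn {h : ℤ} {w : List DStep} (H : PP h w) : NN h w := fun k hk => (H k hk).le

lemma NN_append (h : ℤ) (v w : List DStep) :
    NN h (v ++ w) ↔ NN h v ∧ NN (h + stepSum v) w := by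
  constructor
  · intro H
    refine ⟨fun k hk => ?_, fun k hk => ?_⟩
    · have := H k (by simp; omega)
      rwa [List.take_append_of_le_length hk] at this
    · have := H (v.length + k) (by simp; omega)
      rw [List.take_length_add_append, stepSum_append] at this
      linarith
  · rintro ⟨H1, H2⟩ k hk
    by_cases hkv : k ≤ v.length
    · rw [List.take_append_of_le_length hkv]; exact H1 k hkv
    · obtain ⟨j, rfl⟩ := Nat.exists_eq_add_of_le (not_le.mp hkv).le
      rw [List.take_length_add_append, stepSum_append]
      have := H2 j (by simp at hk; omega)
      linarith

lemma NN_replicate_nonneg (h : ℤ) (n : ℕ) (x : DStep) (hh : 0 ≤ h) (hx : 0 ≤ x.val) :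
    NN h (List.replicate n x) := by
  intro k hk
  simp only [List.take_replicate, stepSum_replicate]
  positivity

lemma NN_replicate_D (h : ℤ) (n : ℕ) (hh : (n : ℤ) ≤ h) :
    NN h (List.replicate n DStep.D) := by
  intro k hk
  simp only [List.take_replicate, stepSum_replicate, List.length_replicate, val_D] at *
  have : ((min k n : ℕ) : ℤ) ≤ n := by exact_mod_cast min_le_right _ _
  linarith

/-- The forbidden words, placed at position `j`. -/
def Q (m d j : ℕ) (W : List DStep) : Prop :=
  (∃ k : ℕ, k + 2 ≤ m ∧ W = [DStep.U] ++ List.replicate (k * d) DStep.L ++ [DStep.D]) ∨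
  (∃ P : List DStep, W = [DStep.U, DStep.U] ++ P ++ [DStep.D, DStep.D] ∧
    (j + 1) % d ≠ 0 ∧ (j + P.length + 3) % d ≠ 0 ∧ stepSum P = 0 ∧
    (∀ k ≤ P.length, 0 ≤ stepSum (P.take k)))

/-- A word placed at position `o` contains a forbidden subword. -/
def Bad (m d o : ℕ) (w : List DStep) : Prop :=
  ∃ pre W suf : List DStep, w = pre ++ W ++ suf ∧ Q m d (o + pre.length) W

lemma good_iff (m d : ℕ) (w : List DStep) :
    (RegularWord m d w ∧ ¬ HasLambda d w) ↔ ¬ Bad m d 0 w := by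
  unfold RegularWord
  rw [← not_or, not_iff_not]
  constructor
  · rintro (⟨k, hk, pre, suf, h⟩ | ⟨pre, P, suf, h, h1, h2, h3, h4⟩)
    · exact ⟨pre, _, suf, h.symm, Or.inl ⟨k, hk, rfl⟩⟩
    · refine ⟨pre, [DStep.U, DStep.U] ++ P ++ [DStep.D, DStep.D], suf, by simp [h],
        Or.inr ⟨P, rfl, by simpa using h1, by simpa using h2, h3, h4⟩⟩
  · rintro ⟨pre, W, suf, h, (⟨k, hk, rfl⟩ | ⟨P, rfl, h1, h2, h3, h4⟩)⟩
    · exact Or.inl ⟨k, hk, pre, suf, h.symm⟩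
    · exact Or.inr ⟨pre, P, suf, by simp [h], by simpa using h1, by simpa using h2, h3, h4⟩

lemma Q_mod {m d j j' : ℕ} {W : List DStep} (h : j % d = j' % d) (H : Q m d j W) :
    Q m d j' W := by
  have key : ∀ r, (j + r) % d = (j' + r) % d := fun r => Nat.ModEq.add_right r h
  rcases H with H | ⟨P, rfl, h1, h2, h3, h4⟩
  · exact Or.inl H
  · refine Or.inr ⟨P, rfl, ?_, ?_, h3, h4⟩
    · rwa [← key]
    · rw [add_assoc] at h2 ⊢; rwa [← key]

lemma Bad_mod {m d o o' : ℕ} {w : List DStep} (h : o % d = o' % d) :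
    Bad m d o w ↔ Bad m d o' w := by
  have : ∀ {o o' : ℕ}, o % d = o' % d → Bad m d o w → Bad m d o' w := by
    rintro o o' h ⟨pre, W, suf, e, q⟩
    exact ⟨pre, W, suf, e, Q_mod (Nat.ModEq.add_right _ h) q⟩
  exact ⟨this h, this h.symm⟩

lemma Q_pos {m d j : ℕ} {W : List DStep} (H : Q m d j W) (k : ℕ) (hk0 : 0 < k)
    (hk : k < W.length) : 0 < stepSum (W.take k) := by
  rcases H with ⟨l, -, rfl⟩ | ⟨P, rfl, -, -, h3, h4⟩
  · rw [List.take_append_of_le_length (by simp at hk ⊢; omega)]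
    obtain ⟨r, rfl⟩ : ∃ r, k = r + 1 := ⟨k - 1, by omega⟩
    simp
  · match k, hk0 with
    | 1, _ => simp
    | r + 2, _ =>
      simp only [List.cons_append, List.nil_append, List.take_succ_cons, stepSum_cons, val_U]
      by_cases hr : r ≤ P.length
      · rw [List.take_append_of_le_length hr]
        have := h4 r hr
        linarith
      · have : r = P.length + 1 := by simp at hk; omega
        subst this
        rw [List.take_length_add_append]
        simp [h3]

lemma Q_hasU {m d j : ℕ} {W : List DStep} (H : Q m d j W) : DStep.U ∈ W := by
  rcases H with ⟨l, -, rfl⟩ | ⟨P, rfl, -, -, h3, h4⟩ <;> simp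

lemma not_Bad_L (m d o n : ℕ) : ¬ Bad m d o (List.replicate n DStep.L) := by
  rintro ⟨pre, W, suf, e, q⟩
  have h : DStep.U ∈ List.replicate n DStep.L := by
    rw [e]; simp [Q_hasU q]
  have := List.eq_of_mem_replicate h
  cases this

lemma Bad_append (m d o : ℕ) (X Y : List DStep) (hX : NN 0 X) (hX0 : stepSum X = 0) :
    Bad m d o (X ++ Y) ↔ Bad m d o X ∨ Bad m d (o + X.length) Y := by
  constructor
  · rintro ⟨pre, W, suf, e, q⟩
    by_cases h1 : X.length ≤ pre.length
    · right
      have hX : X = pre.take X.length := by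
        have := congrArg (List.take X.length) e
        rwa [List.take_left, List.append_assoc, List.take_append_of_le_length h1] at this
      have hp : pre = X ++ pre.drop X.length := by
        conv_lhs => rw [← List.take_append_drop X.length pre, ← hX]
      refine ⟨pre.drop X.length, W, suf, ?_, ?_⟩
      · rw [hp] at e
        simpa using e
      · rw [List.length_drop, add_assoc, Nat.add_sub_cancel' h1]; exact q
    · by_cases h2 : pre.length + W.length ≤ X.length
      · left
        refine ⟨pre, W, X.drop (pre ++ W).length, ?_, q⟩
        have := congrArg (List.take (pre ++ W).length) e
        rw [List.take_left, List.take_append_of_le_length (by simpa using h2)] at this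
        conv_lhs => rw [← List.take_append_drop (pre ++ W).length X, this]
      · exfalso
        obtain ⟨k, hk⟩ := Nat.exists_eq_add_of_le (not_le.mp h1).le
        have hXe : X = pre ++ W.take k := by
          have := congrArg (List.take X.length) e
          rw [List.take_left, List.append_assoc, hk, List.take_length_add_append,
            List.take_append_of_le_length (by omega)] at this
          exact this
        have hpos := Q_pos q k (by omega) (by omega)
        have := hX pre.length (by omega)
        rw [hXe, List.take_left] at this
        rw [hXe, stepSum_append] at hX0
        linarith
  · rintro (⟨pre, W, suf, e, q⟩ | ⟨pre, W, suf, e, q⟩)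
    · exact ⟨pre, W, suf ++ Y, by simp [e], q⟩
    · exact ⟨X ++ pre, W, suf, by simp [e], by simpa [add_assoc] using q⟩

/-- All blocks are pieces. -/
def Blocks (d n : ℕ) (M : List DStep) : Prop :=
  M.length = d * n ∧ ∀ i < n, IsPieceWord d ((M.drop (d * i)).take d)

lemma Blocks_append {d n1 n2 : ℕ} {M1 M2 : List DStep} (h : M1.length = d * n1) :
    Blocks d (n1 + n2) (M1 ++ M2) ↔ Blocks d n1 M1 ∧ Blocks d n2 M2 := by
  have key1 : ∀ i < n1, ((M1 ++ M2).drop (d * i)).take d = (M1.drop (d * i)).take d := by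
    intro i hi
    have : d * i + d ≤ d * n1 := by
      rw [← Nat.mul_succ]; exact Nat.mul_le_mul_left _ hi
    rw [List.drop_append_of_le_length (by omega),
      List.take_append_of_le_length (by rw [List.length_drop]; omega)]
  have key2 : ∀ i, ((M1 ++ M2).drop (d * (n1 + i))).take d = (M2.drop (d * i)).take d := by
    intro i
    rw [mul_add, ← h, List.drop_length_add_append]
  constructor
  · rintro ⟨hl, H⟩
    refine ⟨⟨h, fun i hi => ?_⟩, ⟨?_, fun i hi => ?_⟩⟩
    · rw [← key1 i hi]; exact H i (by omega)
    · rw [List.length_append, mul_add] at hl; omega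
    · rw [← key2 i]; exact H _ (by omega)
  · rintro ⟨⟨-, H1⟩, ⟨hl, H2⟩⟩
    refine ⟨by rw [List.length_append, mul_add]; omega, fun i hi => ?_⟩
    by_cases h' : i < n1
    · rw [key1 i h']; exact H1 i h'
    · obtain ⟨j, rfl⟩ := Nat.exists_eq_add_of_le (not_lt.mp h')
      rw [key2]; exact H2 j (by omega)

lemma Blocks_one {d : ℕ} {M : List DStep} : Blocks d 1 M ↔ IsPieceWord d M := by
  constructor
  · rintro ⟨hl, H⟩
    have := H 0 (by omega)
    simpa [List.take_of_length_le (show M.length ≤ d by omega)] using this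
  · intro H
    have hl : M.length = d := by
      obtain ⟨a, b, c, h, rfl⟩ := H
      simp; omega
    refine ⟨by omega, fun i hi => ?_⟩
    obtain rfl : i = 0 := by omega
    simpa [List.take_of_length_le hl.le] using H

lemma good_def (m d n s t : ℕ) (M : List DStep) : IsGoodPath m d n s t M ↔
    Blocks d n M ∧ (s : ℤ) + stepSum M = t ∧ NN s M ∧ ¬ Bad m d 0 (hatPath d s t M) := by
  unfold IsGoodPath IsDLUPath
  rw [good_iff]
  unfold Blocks NN
  tauto

lemma prime_def (m d n s t : ℕ) (M : List DStep) : IsPrimePath m d n s t M ↔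
    Blocks d n M ∧ (s : ℤ) + stepSum M = t ∧ PP s M ∧ ¬ Bad m d 0 (hatPath d s t M) := by
  have : PP s M → NN s M := PP.nn
  unfold IsPrimePath
  rw [good_def]
  change _ ∧ PP s M ↔ _
  tauto

/-- The piece `D^a L^(d-a-c) U^c`. -/
def pw (d a c : ℕ) : List DStep :=
  List.replicate a DStep.D ++ List.replicate (d - a - c) DStep.L ++ List.replicate c DStep.U

lemma pw_length {d a c : ℕ} (h : a + c ≤ d) : (pw d a c).length = d := by
  simp [pw]; omega

lemma pw_piece {d a c : ℕ} (h : a + c ≤ d) : IsPieceWord d (pw d a c) :=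
  ⟨a, d - a - c, c, by omega, rfl⟩

lemma pw_sum {d a c : ℕ} : stepSum (pw d a c) = c - a := by
  simp [pw]; ring

lemma pw_inj {d a c a' c' : ℕ} (h : pw d a c = pw d a' c') : a = a' ∧ c = c' := by
  constructor
  · have := congrArg (List.count DStep.D) h
    simpa [pw, List.count_replicate] using this
  · have := congrArg (List.count DStep.U) h
    simpa [pw, List.count_replicate] using this

lemma NN_pw {d a c : ℕ} : NN a (pw d a c) := by
  unfold pw
  rw [NN_append, NN_append]
  refine ⟨⟨NN_replicate_D _ _ le_rfl, NN_replicate_nonneg _ _ _ (by simp) (by simp)⟩,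
    NN_replicate_nonneg _ _ _ (by simp) (by simp)⟩

/-- The bad words in a composite path. -/
lemma Bad_comp {m d i s t a c : ℕ} {M1 M2 : List DStep} (hsd : s ≤ d) (hac : a + c ≤ d)
    (hl : M1.length = d * i) (hsum : (s : ℤ) + stepSum M1 = a) (hnn : NN s M1) :
    Bad m d 0 (hatPath d s t (M1 ++ (pw d a c ++ M2))) ↔
      Bad m d 0 (hatPath d s a M1) ∨ Bad m d 0 (hatPath d c t M2) := by
  set X := List.replicate (d - s) DStep.L ++ List.replicate s DStep.U ++ M1 ++
    List.replicate a DStep.D with hXdef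
  set Y := List.replicate (d - a - c) DStep.L ++ List.replicate c DStep.U ++ M2 ++
    List.replicate t DStep.D ++ List.replicate (d - t) DStep.L with hYdef
  have e : hatPath d s t (M1 ++ (pw d a c ++ M2)) = X ++ Y := by
    simp [hatPath, pw, hXdef, hYdef, List.append_assoc]
  have e1 : hatPath d s a M1 = X ++ List.replicate (d - a) DStep.L := by
    simp [hatPath, hXdef, List.append_assoc]
  have e2 : hatPath d c t M2 = List.replicate a DStep.L ++ Y := by
    have : List.replicate (d - c) DStep.L =
        List.replicate a DStep.L ++ List.replicate (d - a - c) DStep.L := by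
      rw [List.replicate_append_replicate]; congr 1; omega
    simp only [hatPath, this, hYdef, List.append_assoc]
  have hX0 : stepSum X = 0 := by
    simp [hXdef]; linarith
  have hX : NN 0 X := by
    rw [hXdef, NN_append, NN_append, NN_append]
    refine ⟨⟨⟨NN_replicate_nonneg _ _ _ (by simp) (by simp),
      NN_replicate_nonneg _ _ _ (by simp) (by simp)⟩, ?_⟩, NN_replicate_D _ _ ?_⟩
    · simpa using hnn
    · simp [hsum]
  have hlX : X.length = d + d * i + a := by
    simp [hXdef, hl]; omega
  rw [e, e1, e2, Bad_append _ _ _ _ _ hX hX0, Bad_append _ _ _ _ _ hX hX0,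
    Bad_append _ _ _ _ _ (NN_replicate_nonneg _ _ _ (by simp) (by simp)) (by simp)]
  have hb := not_Bad_L m d (0 + X.length) (d - a)
  have hb' := not_Bad_L m d 0 a
  have : Bad m d (0 + X.length) Y ↔ Bad m d (0 + (List.replicate a DStep.L).length) Y := by
    apply Bad_mod
    rw [hlX, List.length_replicate]
    have : 0 + (d + d * i + a) = 0 + a + d * (1 + i) := by ring
    rw [this, Nat.add_mul_mod_self_left]
  tauto

lemma comp_good {m d i j s t a c : ℕ} {M1 M2 : List DStep} (hsd : s ≤ d) (hac : a + c ≤ d)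
    (h1 : IsPrimePath m d i s a M1) (h2 : IsGoodPath m d j c t M2) :
    IsGoodPath m d (i + (1 + j)) s t (M1 ++ (pw d a c ++ M2)) := by
  rw [prime_def] at h1
  rw [good_def] at h2 ⊢
  obtain ⟨b1, s1, p1, n1⟩ := h1
  obtain ⟨b2, s2, p2, n2⟩ := h2
  refine ⟨?_, ?_, ?_, ?_⟩
  · rw [Blocks_append b1.1, Blocks_append (by rw [pw_length hac]; simp), Blocks_one]
    exact ⟨b1, pw_piece hac, b2⟩
  · rw [stepSum_append, stepSum_append, pw_sum]; linarith
  · rw [NN_append, NN_append, s1, pw_sum]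
    refine ⟨p1.nn, NN_pw, ?_⟩
    convert p2 using 1; ring
  · rw [Bad_comp hsd hac b1.1 s1 p1.nn]; tauto

lemma decomp_good {m d i j s t a c : ℕ} {M1 M2 : List DStep} (hsd : s ≤ d) (hac : a + c ≤ d)
    (hl : M1.length = d * i) (hsum : (s : ℤ) + stepSum M1 = a) (hp : PP s M1)
    (h : IsGoodPath m d (i + (1 + j)) s t (M1 ++ (pw d a c ++ M2))) :
    IsPrimePath m d i s a M1 ∧ IsGoodPath m d j c t M2 := by
  rw [good_def] at h
  obtain ⟨b, hs, p, n⟩ := h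
  rw [Blocks_append hl, Blocks_append (by rw [pw_length hac]; simp), Blocks_one] at b
  rw [NN_append, NN_append, hsum, pw_sum] at p
  rw [Bad_comp hsd hac hl hsum hp.nn] at n
  rw [stepSum_append, stepSum_append, pw_sum] at hs
  rw [prime_def, good_def]
  refine ⟨⟨b.1, hsum, hp, by tauto⟩, b.2.2, by linarith, ?_, by tauto⟩
  convert p.2.2 using 1; ring

lemma comp_zero {d i s a c : ℕ} {M1 M2 : List DStep}
    (hl : M1.length = d * i) (hsum : (s : ℤ) + stepSum M1 = a) :
    (s : ℤ) + stepSum ((M1 ++ (pw d a c ++ M2)).take (d * i + a)) = 0 := by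
  rw [← hl, List.take_length_add_append, pw, List.append_assoc, List.append_assoc,
    List.take_append_of_le_length (by simp), List.take_of_length_le (by simp), stepSum_append]
  simp; linarith

lemma exists_decomp {m d n s t : ℕ} {M : List DStep} (hd : 1 ≤ d) (hs : 1 ≤ s) (hsd : s ≤ d)
    (h : IsGoodPath m d n s t M) (hnp : ¬ IsPrimePath m d n s t M) :
    ∃ i j a c : ℕ, ∃ M1 M2 : List DStep, n = i + (1 + j) ∧ 1 ≤ a ∧ a + c ≤ d ∧
      M = M1 ++ (pw d a c ++ M2) ∧ IsPrimePath m d i s a M1 ∧ IsGoodPath m d j c t M2 := by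
  classical
  have hgood := h
  rw [good_def] at h
  rw [prime_def] at hnp
  obtain ⟨b, hsum, hnn, hbad⟩ := h
  have hex : ∃ k, k ≤ M.length ∧ (s : ℤ) + stepSum (M.take k) = 0 := by
    by_contra hcon
    push Not at hcon
    exact hnp ⟨b, hsum, fun k hk => lt_of_le_of_ne (hnn k hk) (hcon k hk).symm, hbad⟩
  obtain ⟨hk, hk0⟩ := Nat.find_spec hex
  have hmin : ∀ k' < Nat.find hex, ¬ (k' ≤ M.length ∧ (s : ℤ) + stepSum (M.take k') = 0) :=
    fun k' h' => Nat.find_min hex h'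
  generalize Nat.find hex = k at hk hk0 hmin
  have hkpos : 0 < k := by
    rcases Nat.eq_zero_or_pos k with rfl | h
    · simp at hk0; omega
    · exact h
  obtain ⟨i, hi⟩ : ∃ i, i = (k - 1) / d := ⟨_, rfl⟩
  have hik : d * i < k := by
    have := Nat.mul_div_le (k - 1) d; rw [← hi] at this; omega
  have hki : k ≤ d * i + d := by
    have := Nat.lt_mul_div_succ (k - 1) hd
    rw [← hi, mul_add, mul_one] at this; omega
  have hin : i < n := by
    have : d * i < d * n := by rw [← b.1]; omega
    exact Nat.lt_of_mul_lt_mul_left this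
  obtain ⟨j, rfl⟩ : ∃ j, n = i + (1 + j) := ⟨n - i - 1, by omega⟩
  obtain ⟨a, e, c, habc, hW⟩ := b.2 i hin
  have hW' : (M.drop (d * i)).take d = pw d a c := by
    rw [hW, pw]; congr; omega
  have hac : a + c ≤ d := by omega
  set M1 := M.take (d * i) with hM1
  set M2 := (M.drop (d * i)).drop d with hM2
  have hM : M = M1 ++ (pw d a c ++ M2) := by
    rw [← hW', List.take_append_drop, List.take_append_drop]
  have hl : M1.length = d * i := by
    rw [hM1, List.length_take]; omega
  have hpp : PP s M1 := by
    intro k' hk'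
    rw [hl] at hk'
    rw [hM1, List.take_take, min_eq_left hk']
    exact lt_of_le_of_ne (hnn k' (by omega))
      (fun heq => hmin k' (by omega) ⟨by omega, heq.symm⟩)
  have hle : (a : ℤ) ≤ s + stepSum M1 := by
    have := hnn
    rw [hM, pw, NN_append, NN_append, NN_append, NN_append] at this
    have := this.2.1.1.1 a (by simp)
    simp at this
    linarith
  have hge : (s : ℤ) + stepSum M1 ≤ a := by
    obtain ⟨r, hr0⟩ := Nat.exists_eq_add_of_le hik.le
    have hr : r ≤ (pw d a c).length := by rw [pw_length hac]; omega
    rw [hM, hr0, ← hl, List.take_length_add_append, List.take_append_of_le_length hr,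
      stepSum_append] at hk0
    have := NN_pw (d := d) (a := a) (c := c) r hr
    linarith
  have hsa : (s : ℤ) + stepSum M1 = a := le_antisymm hge hle
  have ha : 1 ≤ a := by
    have := hpp M1.length le_rfl
    rw [List.take_length, hsa] at this
    exact_mod_cast this
  rw [hM] at hgood
  obtain ⟨r1, r2⟩ := decomp_good hsd hac hl hsa hpp hgood
  exact ⟨i, j, a, c, M1, M2, rfl, ha, hac, hM, r1, r2⟩

lemma comp_not_prime {m d i n s t a c : ℕ} {M1 M2 : List DStep} (hac : a + c ≤ d)
    (hl : M1.length = d * i) (hsum : (s : ℤ) + stepSum M1 = a) :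
    ¬ IsPrimePath m d n s t (M1 ++ (pw d a c ++ M2)) := by
  rintro ⟨-, h⟩
  have := h (d * i + a) (by
    rw [List.length_append, List.length_append, pw_length hac, hl]; omega)
  rw [comp_zero hl hsum] at this
  exact lt_irrefl _ this

lemma comp_index_le {m d i s a c i' a' c' : ℕ} {M1 M2 M1' M2' : List DStep}
    (hac : a + c ≤ d) (h1 : IsPrimePath m d i s a M1) (h1' : IsPrimePath m d i' s a' M1')
    (h : M1 ++ (pw d a c ++ M2) = M1' ++ (pw d a' c' ++ M2')) : i' ≤ i := by
  by_contra hlt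
  rw [prime_def] at h1 h1'
  have hmul : d * i + d ≤ d * i' := by
    rw [← Nat.mul_succ]; exact Nat.mul_le_mul_left _ (by omega)
  have hle : d * i + a ≤ M1'.length := by rw [h1'.1.1]; omega
  have hz := comp_zero (c := c) (M2 := M2) h1.1.1 h1.2.1
  rw [h, List.take_append_of_le_length hle] at hz
  have := h1'.2.2.1 _ hle
  linarith

lemma comp_inj {m d i s a c i' a' c' : ℕ} {M1 M2 M1' M2' : List DStep}
    (hac : a + c ≤ d) (hac' : a' + c' ≤ d)
    (h1 : IsPrimePath m d i s a M1) (h1' : IsPrimePath m d i' s a' M1')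
    (h : M1 ++ (pw d a c ++ M2) = M1' ++ (pw d a' c' ++ M2')) :
    i = i' ∧ a = a' ∧ c = c' ∧ M1 = M1' ∧ M2 = M2' := by
  have hi : i = i' := le_antisymm (comp_index_le hac' h1' h1 h.symm)
    (comp_index_le hac h1 h1' h)
  subst hi
  have hl : M1.length = M1'.length := by
    rw [prime_def] at h1 h1'
    rw [h1.1.1, h1'.1.1]
  obtain ⟨e1, e2⟩ := List.append_inj h hl
  obtain ⟨e3, e4⟩ := List.append_inj e2 (by rw [pw_length hac, pw_length hac'])
  obtain ⟨e5, e6⟩ := pw_inj e3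
  exact ⟨rfl, e5, e6, e1, e4⟩

/-- Exchange of up and down steps. -/
def flip : DStep → DStep
  | .U => .D
  | .D => .U
  | .L => .L

/-- Mirror image of a path. -/
def rv (w : List DStep) : List DStep := (w.map flip).reverse

lemma flip_flip (x : DStep) : flip (flip x) = x := by cases x <;> rfl
lemma val_flip (x : DStep) : (flip x).val = - x.val := by cases x <;> rfl

lemma rv_rv (w : List DStep) : rv (rv w) = w := by
  simp [rv, Function.comp_def, flip_flip]
lemma rv_append (v w : List DStep) : rv (v ++ w) = rv w ++ rv v := by simp [rv]
lemma rv_length (w : List DStep) : (rv w).length = w.length := by simp [rv]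
lemma rv_replicate (n : ℕ) (x : DStep) :
    rv (List.replicate n x) = List.replicate n (flip x) := by simp [rv]
lemma rv_sum (w : List DStep) : stepSum (rv w) = - stepSum w := by
  induction w with
  | nil => simp [rv]
  | cons x w ih =>
    have : x :: w = [x] ++ w := rfl
    rw [this, rv_append, stepSum_append, stepSum_append, ih]
    simp [rv, val_flip]

lemma rv_take (w : List DStep) (k : ℕ) : (rv w).take k = rv (w.drop (w.length - k)) := by
  simp [rv, List.take_reverse]

lemma rv_take_sum (w : List DStep) (k : ℕ) :
    stepSum ((rv w).take k) = - stepSum w + stepSum (w.take (w.length - k)) := by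
  rw [rv_take, rv_sum]
  have := congrArg stepSum (List.take_append_drop (w.length - k) w)
  rw [stepSum_append] at this
  linarith

lemma hat_rv (d s t : ℕ) (M : List DStep) : hatPath d t s (rv M) = rv (hatPath d s t M) := by
  simp [hatPath, rv_append, rv_replicate, flip]

lemma mod_rev {d N x y : ℕ} (hN : d ∣ N) (h : x + y = N) (hx : x % d ≠ 0) : y % d ≠ 0 := by
  intro hy
  apply hx
  rw [← h] at hN
  exact Nat.mod_eq_zero_of_dvd ((Nat.dvd_add_left (Nat.dvd_of_mod_eq_zero hy)).mp hN)

lemma Bad_rv_aux {m d : ℕ} {w : List DStep} (hw : d ∣ w.length) (h : Bad m d 0 w) :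
    Bad m d 0 (rv w) := by
  obtain ⟨pre, W, suf, e, q⟩ := h
  refine ⟨rv suf, rv W, rv pre, by rw [e, rv_append, rv_append, List.append_assoc], ?_⟩
  rcases q with ⟨k, hk, rfl⟩ | ⟨P, rfl, h1, h2, h3, h4⟩
  · exact Or.inl ⟨k, hk, by simp [rv, flip]⟩
  · have hlen : w.length = pre.length + (P.length + 4) + suf.length := by
      rw [e]; simp; omega
    refine Or.inr ⟨rv P, by simp [rv, flip], ?_, ?_, ?_, ?_⟩
    · refine mod_rev hw ?_ h2
      rw [hlen, rv_length]; omega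
    · refine mod_rev hw ?_ h1
      rw [hlen, rv_length, rv_length]; omega
    · rw [rv_sum, h3]; rfl
    · intro k hk
      rw [rv_take_sum, h3]
      have := h4 (P.length - k) (by omega)
      linarith

lemma Blocks_rv {d n : ℕ} {M : List DStep} (h : Blocks d n M) : Blocks d n (rv M) := by
  induction n generalizing M with
  | zero => exact ⟨by rw [rv_length]; exact h.1, by simp⟩
  | succ n ih =>
    have hl : (M.take (d * n)).length = d * n := by
      rw [List.length_take, h.1, mul_add]; omega
    rw [← List.take_append_drop (d * n) M, Blocks_append hl] at h
    obtain ⟨h1, h2⟩ := h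
    rw [← List.take_append_drop (d * n) M, rv_append, add_comm,
      Blocks_append (by rw [rv_length]; exact h2.1)]
    refine ⟨?_, ih h1⟩
    rw [Blocks_one] at h2 ⊢
    obtain ⟨a, b, c, habc, e⟩ := h2
    exact ⟨c, b, a, by omega, by rw [e]; simp [rv_append, rv_replicate, flip]⟩

lemma prime_rv {m d n s t : ℕ} {M : List DStep} (hsd : s ≤ d) (htd : t ≤ d)
    (h : IsPrimePath m d n s t M) : IsPrimePath m d n t s (rv M) := by
  rw [prime_def] at h ⊢
  obtain ⟨b, hsum, hp, hb⟩ := h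
  refine ⟨Blocks_rv b, by rw [rv_sum]; linarith, ?_, ?_⟩
  · intro k hk
    rw [rv_take_sum]
    have := hp (M.length - k) (by omega)
    linarith
  · intro hbad
    apply hb
    rw [hat_rv] at hbad
    have := Bad_rv_aux (by
      rw [rv_length]
      refine ⟨n + 2, ?_⟩
      simp only [hatPath, List.length_append, List.length_replicate, b.1]
      rw [mul_add]; omega) hbad
    rwa [rv_rv] at this

lemma good_finite (m d n s t : ℕ) : {M : List DStep | IsGoodPath m d n s t M}.Finite :=
  (List.finite_length_eq DStep (d * n)).subset fun _ h => h.1.1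

lemma prime_finite (m d n s t : ℕ) : {M : List DStep | IsPrimePath m d n s t M}.Finite :=
  (good_finite m d n s t).subset fun _ h => h.1

lemma aCount_symm {m d n s t : ℕ} (hsd : s ≤ d) (htd : t ≤ d) :
    aCount m d n s t = aCount m d n t s := by
  have key : ∀ {s t : ℕ}, s ≤ d → t ≤ d → aCount m d n s t ≤ aCount m d n t s := by
    intro s t hsd htd
    refine Set.ncard_le_ncard_of_injOn rv (fun M h => prime_rv hsd htd h) ?_
      (prime_finite m d n t s)
    intro x _ y _ h
    rw [← rv_rv x, h, rv_rv]
  exact le_antisymm (key hsd htd) (key htd hsd)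

/-- Good paths as a finset. -/
noncomputable def GF (m d n s t : ℕ) : Finset (List DStep) := (good_finite m d n s t).toFinset
/-- Prime paths as a finset. -/
noncomputable def AF (m d n s t : ℕ) : Finset (List DStep) := (prime_finite m d n s t).toFinset

lemma mem_GF {m d n s t : ℕ} {M : List DStep} : M ∈ GF m d n s t ↔ IsGoodPath m d n s t M := by
  simp [GF]
lemma mem_AF {m d n s t : ℕ} {M : List DStep} : M ∈ AF m d n s t ↔ IsPrimePath m d n s t M := by
  simp [AF]
lemma card_GF (m d n s t : ℕ) : (GF m d n s t).card = gCount m d n s t :=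
  (Set.ncard_eq_toFinset_card _ (good_finite m d n s t)).symm
lemma card_AF (m d n s t : ℕ) : (AF m d n s t).card = aCount m d n s t :=
  (Set.ncard_eq_toFinset_card _ (prime_finite m d n s t)).symm

lemma AF_sub (m d n s t : ℕ) : AF m d n s t ⊆ GF m d n s t := by
  intro M h
  rw [mem_GF]; rw [mem_AF] at h; exact h.1

lemma gCount_zero {m d s t : ℕ} (hd : 1 ≤ d) (hs : 1 ≤ s) (hsd : s ≤ d) :
    gCount m d 0 s t = aCount m d 0 s t := by
  rw [← card_GF, ← card_AF]
  congr 1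
  refine Finset.Subset.antisymm (fun M h => ?_) (AF_sub _ _ _ _ _)
  rw [mem_GF] at h
  rw [mem_AF]
  by_contra hn
  obtain ⟨i, j, a, c, M1, M2, h0, -⟩ := exists_decomp hd hs hsd h hn
  omega

lemma gCount_succ {m d n s t : ℕ} (hd : 1 ≤ d) (hs : 1 ≤ s) (hsd : s ≤ d) :
    gCount m d (n + 1) s t = aCount m d (n + 1) s t +
      ∑ a ∈ Finset.Icc 1 d, ∑ c ∈ Finset.range (d - a + 1),
        ∑ p ∈ Finset.HasAntidiagonal.antidiagonal n, aCount m d p.1 s a * gCount m d p.2 c t := by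
  classical
  rw [← card_GF, ← card_AF, ← Finset.card_sdiff_add_card_eq_card (AF_sub m d (n + 1) s t),
    add_comm]
  congr 1
  let I : Finset (Σ _ : (Σ _ : ℕ, ℕ), ℕ × ℕ) :=
    ((Finset.Icc 1 d).sigma fun a => Finset.range (d - a + 1)).sigma
      fun _ => Finset.HasAntidiagonal.antidiagonal n
  let F : (Σ _ : (Σ _ : ℕ, ℕ), ℕ × ℕ) → Finset (List DStep × List DStep) := fun x =>
    AF m d x.2.1 s x.1.1 ×ˢ GF m d x.2.2 x.1.2 t
  have hcard : (I.sigma F).card = ∑ a ∈ Finset.Icc 1 d, ∑ c ∈ Finset.range (d - a + 1),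
        ∑ p ∈ Finset.HasAntidiagonal.antidiagonal n, aCount m d p.1 s a * gCount m d p.2 c t := by
    rw [Finset.card_sigma, Finset.sum_sigma, Finset.sum_sigma]
    simp only [F, Finset.card_product, card_GF, card_AF]
  rw [← hcard]
  symm
  have hmem : ∀ x : (Σ _ : (Σ _ : (Σ _ : ℕ, ℕ), ℕ × ℕ), List DStep × List DStep),
      x ∈ I.sigma F ↔ (1 ≤ x.1.1.1 ∧ x.1.1.1 + x.1.1.2 ≤ d) ∧ x.1.2.1 + x.1.2.2 = n ∧
        IsPrimePath m d x.1.2.1 s x.1.1.1 x.2.1 ∧ IsGoodPath m d x.1.2.2 x.1.1.2 t x.2.2 := by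
    rintro ⟨⟨⟨a, c⟩, ⟨i, j⟩⟩, ⟨M1, M2⟩⟩
    simp only [I, F, Finset.mem_sigma, Finset.mem_product, mem_AF, mem_GF, Finset.mem_Icc,
      Finset.mem_range, Finset.HasAntidiagonal.mem_antidiagonal, and_assoc]
    constructor
    · rintro ⟨h1, h2, h3, h4⟩
      exact ⟨h1, by omega, h4⟩
    · rintro ⟨h1, h2, h4⟩
      exact ⟨h1, by omega, by omega, h4⟩
  refine Finset.card_nbij (fun x => x.2.1 ++ (pw d x.1.1.1 x.1.1.2 ++ x.2.2)) ?_ ?_ ?_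
  · intro x hx
    obtain ⟨⟨h1, h2⟩, h3, h4, h5⟩ := (hmem x).mp hx
    refine Finset.mem_coe.mpr (Finset.mem_sdiff.mpr ⟨?_, ?_⟩)
    · rw [mem_GF]
      have := comp_good hsd h2 h4 h5
      rwa [show x.1.2.1 + (1 + x.1.2.2) = n + 1 by omega] at this
    · rw [mem_AF]
      rw [prime_def] at h4
      exact comp_not_prime h2 h4.1.1 h4.2.1
  · intro x hx y hy hxy
    obtain ⟨⟨h1, h2⟩, h3, h4, h5⟩ := (hmem x).mp (Finset.mem_coe.mp hx)
    obtain ⟨⟨h1', h2'⟩, h3', h4', h5'⟩ := (hmem y).mp (Finset.mem_coe.mp hy)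
    obtain ⟨e1, e2, e3, e4, e5⟩ := comp_inj h2 h2' h4 h4' hxy
    have e6 : x.1.2.2 = y.1.2.2 := by omega
    obtain ⟨⟨⟨a, c⟩, ⟨i, j⟩⟩, ⟨M1, M2⟩⟩ := x
    obtain ⟨⟨⟨a', c'⟩, ⟨i', j'⟩⟩, ⟨M1', M2'⟩⟩ := y
    simp only at e1 e2 e3 e4 e5 e6
    subst e1 e2 e3 e4 e5 e6
    rfl
  · intro M hM
    rw [Finset.mem_coe, Finset.mem_sdiff, mem_GF, mem_AF] at hM
    obtain ⟨i, j, a, c, M1, M2, h0, ha, hac, e, h1, h2⟩ := exists_decomp hd hs hsd hM.1 hM.2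
    refine ⟨⟨⟨⟨a, c⟩, ⟨i, j⟩⟩, ⟨M1, M2⟩⟩, ?_, e.symm⟩
    rw [Finset.mem_coe, hmem]
    exact ⟨⟨ha, hac⟩, by simp only; omega, h1, h2⟩

lemma mk_expand (d : ℕ) (hd : d ≠ 0) (f : ℕ → ℤ) :
    (PowerSeries.mk fun N => if d ∣ N then f (N / d) else 0) =
      PowerSeries.expand d hd (PowerSeries.mk f) := by
  ext N
  rw [PowerSeries.coeff_expand]
  simp

end DLUAux

theorem stmt11 (m d s t : ℕ) (hm : 1 ≤ m) (hd : 1 ≤ d) (hs : 1 ≤ s) (hsd : s ≤ d)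
    (hts : t ≤ s) :
    Gps m d s t =
      Aps m d s t +
      (PowerSeries.X : PowerSeries ℤ) ^ d *
        ∑ a ∈ Finset.Icc 1 d, ∑ c ∈ Finset.range (d - a + 1),
          Aps m d (max s a) (min s a) * Gps m d c t := by

  have hd0 : d ≠ 0 := by omega
  have hG : ∀ s t, Gps m d s t =
      PowerSeries.expand d hd0 (PowerSeries.mk fun n => (gCount m d n s t : ℤ)) :=
    fun s t => DLUAux.mk_expand d hd0 fun n => (gCount m d n s t : ℤ)
  have hA : ∀ s t, Aps m d s t =
      PowerSeries.expand d hd0 (PowerSeries.mk fun n => (aCount m d n s t : ℤ)) :=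
    fun s t => DLUAux.mk_expand d hd0 fun n => (aCount m d n s t : ℤ)
  have hX : (PowerSeries.X : PowerSeries ℤ) ^ d = PowerSeries.expand d hd0 PowerSeries.X := by
    rw [PowerSeries.expand_X]
  simp only [hG, hA, hX, ← map_mul, ← map_sum, ← map_add]
  congr 1
  ext n
  cases n with
  | zero =>
    simp [DLUAux.gCount_zero hd hs hsd]
  | succ n =>
    rw [map_add, PowerSeries.coeff_succ_X_mul, PowerSeries.coeff_mk, PowerSeries.coeff_mk,
      DLUAux.gCount_succ hd hs hsd]
    push_cast
    congr 1
    rw [map_sum]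
    refine Finset.sum_congr rfl fun a ha => ?_
    rw [map_sum]
    refine Finset.sum_congr rfl fun c _ => ?_
    rw [PowerSeries.coeff_mul]
    refine Finset.sum_congr rfl fun p _ => ?_
    rw [PowerSeries.coeff_mk, PowerSeries.coeff_mk]
    have had : a ≤ d := (Finset.mem_Icc.mp ha).2
    rcases le_total s a with h | h
    · rw [max_eq_right h, min_eq_left h, DLUAux.aCount_symm hsd had]
    · rw [max_eq_left h, min_eq_right h]
end
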